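/- arXiv:2507.20482 — 2 statements merged into one kernel-verified Lean document; each statement's English description precedes it below -/
import Mathlib

section
/- Let q ≥ 2 be an integer and β > q, and let c(β,q) = (2·log(1/F′(a)))⁻¹. There exists ε₀ > 0 such that for every real γ there exist constants C₁(γ) ≥ C₀(γ) > 0 with the following property: for every η > 0 there is N such that for all n ≥ N, all x₀ with |x₀ − a| ≤ ε₀, and every integer T with c(β,q)·log n + γ ≤ T ≤ c(β,q)·log n + γ + 1, one has |x₀ − a|·C₀(γ)/√n − η/√n ≤ |F^T(x₀) − a| ≤ |x₀ − a|·C₁(γ)/√n + η/√n, where F^T denotes the T-fold iterate of F. -/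
open scoped Classical
open Finset

/-- Spin configurations on `n` vertices with `q` spins. -/
abbrev Conf (n q : ℕ) := Fin n → Fin q

/-- Number of vertices assigned spin `j`. -/
def cntN {n q : ℕ} (X : Conf n q) (j : Fin q) : ℕ :=
  (Finset.univ.filter (fun v => X v = j)).card

/-- Number of monochromatic pairs `{u,v}` (`u < v`, same spin). -/
def numMono {n q : ℕ} (σ : Conf n q) : ℕ :=
  (Finset.univ.filter (fun p : Fin n × Fin n => p.1 < p.2 ∧ σ p.1 = σ p.2)).card

/-- The mean-field `q`-state Potts measure: probability of `σ`. -/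
noncomputable def pottsProb (n q : ℕ) (β : ℝ) (σ : Conf n q) : ℝ :=
  Real.exp (β / n * numMono σ) / ∑ τ : Conf n q, Real.exp (β / n * numMono τ)

/-- The set of monochromatic pairs of a configuration. -/
def monoPairs {n q : ℕ} (σ : Conf n q) : Finset (Fin n × Fin n) :=
  Finset.univ.filter (fun p : Fin n × Fin n => p.1 < p.2 ∧ σ p.1 = σ p.2)

/-- The graph on `Fin n` whose edges are the pairs in `E`. -/
def graphOf {n : ℕ} (E : Finset (Fin n × Fin n)) : SimpleGraph (Fin n) :=
  SimpleGraph.fromRel (fun u v => (u, v) ∈ E)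

/-- Number of connected components of the graph `(V, E)`. -/
noncomputable def numComps {n : ℕ} (E : Finset (Fin n × Fin n)) : ℕ :=
  Nat.card (graphOf E).ConnectedComponent

/-- One-step transition probability of the Swendsen–Wang dynamics:
percolate on monochromatic pairs with probability `p = 1 - exp (-β/n)`,
then color each connected component uniformly at random. -/
noncomputable def swStep (n q : ℕ) (β : ℝ) (σ τ : Conf n q) : ℝ :=
  ∑ E ∈ (monoPairs σ).powerset,
    ((1 - Real.exp (-(β / n))) ^ E.card *
        Real.exp (-(β / n)) ^ ((monoPairs σ).card - E.card)) *
      (if ∀ u v : Fin n, (graphOf E).Reachable u v → τ u = τ v then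
        ((q : ℝ))⁻¹ ^ numComps E else 0)

/-- `t`-step transition probability of the Swendsen–Wang dynamics. -/
noncomputable def swProb (n q : ℕ) (β : ℝ) : ℕ → Conf n q → Conf n q → ℝ
  | 0, σ, τ => if σ = τ then 1 else 0
  | t + 1, σ, τ => ∑ η : Conf n q, swStep n q β σ η * swProb n q β t η τ

/-- Probability of observing the trajectory `ω 0, ω 1, …, ω (ℓ-1)` at times
`1, …, ℓ` for the SW dynamics started at `X₀`. -/
noncomputable def pathProb (n q : ℕ) (β : ℝ) (X₀ : Conf n q) (ℓ : ℕ)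
    (ω : Fin ℓ → Conf n q) : ℝ :=
  ∏ i : Fin ℓ, swStep n q β
    (if _h : 0 < (i : ℕ) then
        ω ⟨(i : ℕ) - 1, lt_of_le_of_lt (Nat.sub_le _ _) i.isLt⟩
      else X₀) (ω i)

/-- Total variation distance between two probability vectors on configurations. -/
noncomputable def tvDist {n q : ℕ} (f g : Conf n q → ℝ) : ℝ :=
  (∑ τ : Conf n q, |f τ - g τ|) / 2

/-- Mixing time `τ_mix(ε)` of the SW dynamics. -/
noncomputable def mixingTime (n q : ℕ) (β ε : ℝ) : ℕ :=
  sInf {t : ℕ | ∀ σ : Conf n q, tvDist (swProb n q β t σ) (pottsProb n q β) ≤ ε}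

/-- `theta lam` is the unique root in `(0,1)` of `exp (-lam * x) = 1 - x`
for `lam > 1`, and `0` for `lam ≤ 1`. -/
noncomputable def theta (lam : ℝ) : ℝ :=
  if lam ≤ 1 then 0
  else sSup {x : ℝ | x ∈ Set.Ioo (0 : ℝ) 1 ∧ Real.exp (-lam * x) = 1 - x}

/-- The drift function `F`. -/
noncomputable def F (q : ℕ) (β : ℝ) (x : ℝ) : ℝ :=
  1 / q + (1 - 1 / q) * theta (β * x) * x

/-- The unique fixed point of `F` in `(1/q, 1]` (for `β > q`). -/
noncomputable def aFix (q : ℕ) (β : ℝ) : ℝ :=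
  sSup {x : ℝ | x ∈ Set.Ioc (1 / (q : ℝ)) 1 ∧ F q β x = x}

/-- The cutoff constant `c(β,q) = (2 log (1 / F'(a)))⁻¹`. -/
noncomputable def cConst (q : ℕ) (β : ℝ) : ℝ :=
  (2 * Real.log (1 / deriv (F q β) (aFix q β)))⁻¹

/-- Fraction of vertices assigned spin `j`. -/
noncomputable def cntFrac {n q : ℕ} (X : Conf n q) : Fin q → ℝ :=
  fun j => (cntN X j : ℝ) / n

/-- The proportions vector `α(X)`: fractions of vertices of each spin,
sorted in nonincreasing order. -/
noncomputable def alphaVec {n q : ℕ} (X : Conf n q) : Fin q → ℝ :=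
  fun i => cntFrac X (Tuple.sort (cntFrac X) i.rev)

/-- `ℓ∞` distance between two vectors indexed by `Fin q`. -/
noncomputable def linf {q : ℕ} (f g : Fin q → ℝ) : ℝ :=
  ⨆ i : Fin q, |f i - g i|

/-- The vector `κ(b) = (b, (1-b)/(q-1), …, (1-b)/(q-1))`. -/
noncomputable def kappaVec (q : ℕ) (b : ℝ) : Fin q → ℝ :=
  fun i => if (i : ℕ) = 0 then b else (1 - b) / ((q : ℝ) - 1)

/-- The majority vector `m = (a, (1-a)/(q-1), …, (1-a)/(q-1))`. -/
noncomputable def mVec (q : ℕ) (β : ℝ) : Fin q → ℝ :=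
  kappaVec q (aFix q β)

/-- Index of the most common spin of `X` (least such index on ties). -/
noncomputable def domIdx {n q : ℕ} (X : Conf n q) : ℕ :=
  sInf {j : ℕ | ∃ hj : j < q, ∀ j' : Fin q, cntN X j' ≤ cntN X ⟨j, hj⟩}

/-- `α₁(X)`: fraction of vertices carrying the most common spin of `X`. -/
noncomputable def alpha1 {n q : ℕ} (X : Conf n q) : ℝ :=
  ((Finset.univ.filter (fun v : Fin n => (X v : ℕ) = domIdx X)).card : ℝ) / n

/-- `α_{1,k}(X)`: fraction of vertices of `Vk` carrying the most common spin of `X`. -/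
noncomputable def alpha1In {n q : ℕ} (X : Conf n q) (Vk : Finset (Fin n)) : ℝ :=
  ((Vk.filter (fun v => (X v : ℕ) = domIdx X)).card : ℝ) / Vk.card

/-- `P` is a partition of the vertex set into `q` classes. -/
def IsPartition {n q : ℕ} (P : Fin q → Finset (Fin n)) : Prop :=
  (∀ i j, i ≠ j → Disjoint (P i) (P j)) ∧ ∀ v : Fin n, ∃ i, v ∈ P i

/-- A `λ`-partition: a partition with all classes of size at least `λ n`. -/
def IsLamPartition {n q : ℕ} (lam : ℝ) (P : Fin q → Finset (Fin n)) : Prop :=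
  IsPartition P ∧ ∀ i, lam * n ≤ ((P i).card : ℝ)

/-- Projection: `projCnt P X i j` is the number of vertices of `P i`
assigned spin `j` in `X`. -/
def projCnt {n q : ℕ} (P : Fin q → Finset (Fin n)) (X : Conf n q) :
    Fin q → Fin q → ℕ :=
  fun i j => ((P i).filter (fun v => X v = j)).card

/-- All potential edges of the complete graph on `Fin n`. -/
def allPairs (n : ℕ) : Finset (Fin n × Fin n) :=
  Finset.univ.filter (fun p : Fin n × Fin n => p.1 < p.2)

/-- Probability of the edge set `E` under the Erdős–Rényi measure `G(n,p)`. -/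
noncomputable def erProb (n : ℕ) (p : ℝ) (E : Finset (Fin n × Fin n)) : ℝ :=
  p ^ E.card * (1 - p) ^ ((allPairs n).card - E.card)

/-- Size of the connected component of `v` in the graph `(V, E)`. -/
noncomputable def compCard {n : ℕ} (E : Finset (Fin n × Fin n)) (v : Fin n) : ℕ :=
  (Finset.univ.filter (fun u => (graphOf E).Reachable v u)).card

/-- `L₁`: size of the largest connected component. -/
noncomputable def L1 {n : ℕ} (E : Finset (Fin n × Fin n)) : ℕ :=
  Finset.univ.sup (fun v => compCard E v)

/-- Sum of the squares of the component sizes, `Σ_j L_j²`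
(computed as `Σ_v |C(v)|`). -/
noncomputable def sumCompSq {n : ℕ} (E : Finset (Fin n × Fin n)) : ℕ :=
  ∑ v : Fin n, compCard E v

/-- Expectation of `f` under the Erdős–Rényi measure `G(n,p)`. -/
noncomputable def erExp (n : ℕ) (p : ℝ) (f : Finset (Fin n × Fin n) → ℝ) : ℝ :=
  ∑ E ∈ (allPairs n).powerset, erProb n p E * f E

/-- Random-cluster weight of an edge set with parameters `q`, `p = 1 - exp (-β/n)`. -/
noncomputable def rcWeight (n q : ℕ) (β : ℝ) (E : Finset (Fin n × Fin n)) : ℝ :=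
  (1 - Real.exp (-(β / n))) ^ E.card *
    Real.exp (-(β / n)) ^ ((allPairs n).card - E.card) * (q : ℝ) ^ numComps E

/-- The mean-field random-cluster measure: probability of the edge set `E`. -/
noncomputable def rcProb (n q : ℕ) (β : ℝ) (E : Finset (Fin n × Fin n)) : ℝ :=
  rcWeight n q β E / ∑ B ∈ (allPairs n).powerset, rcWeight n q β B

/-- The inverse branch of `theta`: `theta (lamOf u) = 1 - exp (-u)` for `u > 0`. -/
noncomputable def lamOf (u : ℝ) : ℝ := u / (1 - Real.exp (-u))

lemma one_sub_exp_neg_pos {u : ℝ} (hu : 0 < u) : 0 < 1 - Real.exp (-u) := by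
  have : Real.exp (-u) < 1 := by simpa using hu
  linarith

lemma one_add_mul_exp_neg_lt {u : ℝ} (hu : 0 < u) : (1 + u) * Real.exp (-u) < 1 := by
  have h1 : 1 + u < Real.exp u := by linarith [Real.add_one_lt_exp hu.ne']
  have h2 : Real.exp u * Real.exp (-u) = 1 := by rw [← Real.exp_add]; simp
  nlinarith [Real.exp_pos (-u)]

lemma sq_mul_exp_neg_le {u : ℝ} (hu : 0 < u) :
    u ^ 2 * Real.exp (-u) ≤ (1 - Real.exp (-u)) ^ 2 := by
  have hs : u / 2 ≤ Real.sinh (u / 2) := Real.self_le_sinh_iff.2 (by linarith)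
  rw [Real.sinh_eq] at hs
  have hm : Real.exp (u / 2) * Real.exp (-(u / 2)) = 1 := by rw [← Real.exp_add]; simp
  have he : Real.exp (-u) = Real.exp (-(u / 2)) ^ 2 := by
    rw [← Real.exp_nat_mul]; congr 1; push_cast; ring
  have hp := Real.exp_pos (-(u / 2))
  have hle : u * Real.exp (-(u / 2)) ≤ 1 - Real.exp (-u) := by
    rw [he]; nlinarith
  rw [he] at hle ⊢
  calc u ^ 2 * Real.exp (-(u / 2)) ^ 2 = (u * Real.exp (-(u / 2))) ^ 2 := by ring
    _ ≤ _ := pow_le_pow_left₀ (by positivity) hle 2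

lemma one_lt_lamOf {u : ℝ} (hu : 0 < u) : 1 < lamOf u := by
  have h := one_sub_exp_neg_pos hu
  rw [lamOf, one_lt_div h]
  linarith [Real.add_one_lt_exp (neg_ne_zero.2 hu.ne')]

lemma hasDerivAt_lamOf {u : ℝ} (hu : 0 < u) :
    HasDerivAt lamOf ((1 - (1 + u) * Real.exp (-u)) / (1 - Real.exp (-u)) ^ 2) u := by
  have h1 : HasDerivAt (fun u : ℝ => 1 - Real.exp (-u)) (Real.exp (-u)) u := by
    simpa using ((hasDerivAt_neg u).exp).const_sub 1
  exact ((hasDerivAt_id' u).fun_div h1 (one_sub_exp_neg_pos hu).ne').congr_deriv (by ring)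

lemma deriv_lamOf_pos {u : ℝ} (hu : 0 < u) :
    0 < (1 - (1 + u) * Real.exp (-u)) / (1 - Real.exp (-u)) ^ 2 := by
  have h := one_sub_exp_neg_pos hu
  have h' := one_add_mul_exp_neg_lt hu
  apply div_pos (by linarith) (by positivity)

lemma strictMonoOn_lamOf : StrictMonoOn lamOf (Set.Ioi 0) := by
  apply strictMonoOn_of_deriv_pos (convex_Ioi 0)
  · exact fun u hu => (hasDerivAt_lamOf hu).continuousAt.continuousWithinAt
  · intro u hu
    rw [interior_Ioi] at hu
    rw [(hasDerivAt_lamOf hu).deriv]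
    exact deriv_lamOf_pos hu

lemma le_mul_one_sub_exp_neg {k : ℝ} (hk : 1 < k) :
    k - 1 ≤ k * (1 - Real.exp (-(k - 1))) := by
  have h1 := Real.add_one_le_exp (k - 1)
  have h2 : Real.exp (k - 1) * Real.exp (-(k - 1)) = 1 := by rw [← Real.exp_add]; simp
  nlinarith [Real.exp_pos (-(k - 1))]

lemma exists_lamOf_eq {lam : ℝ} (h : 1 < lam) : ∃ u, 0 < u ∧ lamOf u = lam := by
  have hc : ContinuousOn (fun u : ℝ => u - lam * (1 - Real.exp (-u)))
      (Set.Icc (lam - 1) lam) := by fun_prop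
  have hmem : (0 : ℝ) ∈ Set.Icc ((lam - 1) - lam * (1 - Real.exp (-(lam - 1))))
      (lam - lam * (1 - Real.exp (-lam))) :=
    ⟨by linarith [le_mul_one_sub_exp_neg h], by nlinarith [Real.exp_pos (-lam)]⟩
  obtain ⟨u, hu, hu0⟩ := intermediate_value_Icc (by linarith) hc hmem
  have hpos : 0 < u := by linarith [hu.1]
  refine ⟨u, hpos, ?_⟩
  rw [lamOf, div_eq_iff (one_sub_exp_neg_pos hpos).ne']
  simp only at hu0
  linarith

lemma theta_lamOf {u : ℝ} (hu : 0 < u) : theta (lamOf u) = 1 - Real.exp (-u) := by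
  have hpos := one_sub_exp_neg_pos hu
  rw [theta, if_neg (not_le.2 (one_lt_lamOf hu))]
  suffices {x : ℝ | x ∈ Set.Ioo (0 : ℝ) 1 ∧ Real.exp (-lamOf u * x) = 1 - x}
      = {1 - Real.exp (-u)} by rw [this, csSup_singleton]
  ext y
  simp only [Set.mem_ofPred_eq, Set.mem_singleton_iff]
  constructor
  · rintro ⟨⟨hy0, hy1⟩, hy⟩
    have hw : 0 < lamOf u * y := mul_pos (by linarith [one_lt_lamOf hu]) hy0
    have hy' : 1 - Real.exp (-(lamOf u * y)) = y := by rw [← neg_mul, hy]; ring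
    have heq : lamOf (lamOf u * y) = lamOf u := by
      rw [lamOf, hy', mul_div_cancel_right₀ _ hy0.ne']
    rw [← strictMonoOn_lamOf.injOn hw hu heq, hy']
  · rintro rfl
    refine ⟨⟨hpos, by linarith [Real.exp_pos (-u)]⟩, ?_⟩
    rw [neg_mul, lamOf, div_mul_cancel₀ _ hpos.ne']
    ring

lemma contDiffAt_theta {u : ℝ} (hu : 0 < u) : ContDiffAt ℝ 2 theta (lamOf u) := by
  have hc : ContDiffAt ℝ 2 lamOf u := by
    unfold lamOf
    exact contDiffAt_id.div (by fun_prop) (one_sub_exp_neg_pos hu).ne'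
  have hd := hasDerivAt_lamOf hu
  have hs : HasStrictDerivAt lamOf _ u := hc.hasStrictDerivAt' hd (by norm_num)
  have hf := hs.hasStrictFDerivAt_equiv (deriv_lamOf_pos hu).ne'
  have hinv := hc.to_localInverse hf.hasFDerivAt (by norm_num)
  set g := hc.localInverse hf.hasFDerivAt (by norm_num)
  have hright : ∀ᶠ y in nhds (lamOf u), lamOf (g y) = y := hf.eventually_right_inverse
  have hgu : g (lamOf u) = u := hf.localInverse_apply_image
  have hposv : ∀ᶠ y in nhds (lamOf u), 0 < g y :=
    hinv.continuousAt.eventually (by rw [hgu]; exact lt_mem_nhds hu)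
  have hsm : ContDiffAt ℝ 2 (fun y => 1 - Real.exp (-g y)) (lamOf u) :=
    contDiffAt_const.sub hinv.neg.exp
  apply hsm.congr_of_eventuallyEq
  filter_upwards [hright, hposv] with y hy hp
  rw [← theta_lamOf hp, hy]

/-- If `f` is twice continuously differentiable at a fixed point with multiplier in `(0, 1)`,
the orbits of nearby points decay exactly geometrically, up to a factor `2`. -/
lemma exists_iterate_sub_bounds {f : ℝ → ℝ} {a : ℝ} (hfa : f a = a) (hf : ContDiffAt ℝ 2 f a)
    (hL0 : 0 < deriv f a) (hL1 : deriv f a < 1) :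
    ∃ ε > 0, ∀ x, |x - a| ≤ ε → ∀ t : ℕ,
      deriv f a ^ t * |x - a| / 2 ≤ |f^[t] x - a| ∧
        |f^[t] x - a| ≤ 2 * (deriv f a ^ t * |x - a|) := by
  set L := deriv f a
  have hquad : ∃ K > 0, ∃ δ > 0, ∀ x, |x - a| < δ → |f x - a - L * (x - a)| ≤ K * (x - a) ^ 2 := by
    have hdd : DifferentiableAt ℝ (deriv f) a :=
      ContDiffAt.differentiableAt (n := 1)
      (hf.derivWithin (by norm_num)) one_ne_zero
    obtain ⟨K, hK, hbound⟩ := hdd.hasDerivAt.isBigO_sub.exists_pos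
    have hdiff : ∀ᶠ x in nhds a, DifferentiableAt ℝ f x := by
      filter_upwards [hf.eventually (by simp)] with x hx using hx.differentiableAt (by norm_num)
    obtain ⟨δ, hδ, hball⟩ := Metric.eventually_nhds_iff.1 (hbound.bound.and hdiff)
    refine ⟨K, hK, δ, hδ, fun x hx => ?_⟩
    have hmv := (convex_closedBall a |x - a|).norm_image_sub_le_of_norm_hasDerivWithin_le
      (f := fun y => f y - L * y) (f' := fun y => deriv f y - L) (C := K * |x - a|)
      (x := a) (y := x) (fun y hy => ?_) (fun y hy => ?_) (by simp) (by simp [Real.dist_eq])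
    · rw [Real.norm_eq_abs, Real.norm_eq_abs] at hmv
      calc |f x - a - L * (x - a)| = |f x - L * x - (f a - L * a)| := by rw [hfa]; ring_nf
        _ ≤ K * |x - a| * |x - a| := hmv
        _ = K * (x - a) ^ 2 := by rw [mul_assoc, abs_mul_abs_self]; ring
    · rw [Metric.mem_closedBall] at hy
      have hd := (hball (lt_of_le_of_lt hy hx)).2.hasDerivAt
      simpa using (hd.fun_sub ((hasDerivAt_id' y).const_mul L)).hasDerivWithinAt
    · rw [Metric.mem_closedBall, Real.dist_eq] at hy
      refine (hball (lt_of_le_of_lt (by rwa [Real.dist_eq]) hx)).1.trans ?_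
      rw [Real.norm_eq_abs]
      gcongr
  obtain ⟨K, hK, δ, hδ, hquad⟩ := hquad
  have hgap : 0 < L * (1 - L) := mul_pos hL0 (by linarith)
  refine ⟨min (δ / 4) (L * (1 - L) / (8 * K)), by positivity, fun x hx t => ?_⟩
  have hxδ : |x - a| ≤ δ / 4 := hx.trans (min_le_left _ _)
  have hxK : 8 * K * |x - a| ≤ L * (1 - L) := by
    have := hx.trans (min_le_right _ _)
    rw [le_div_iff₀ (by positivity)] at this
    linarith
  have hd := abs_nonneg (x - a)
  have hpow : ∀ s : ℕ, 0 < L ^ s ∧ L ^ s ≤ 1 := fun s =>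
    ⟨pow_pos hL0 s, pow_le_one₀ hL0.le hL1.le⟩
  have hupper : ∀ s : ℕ, |f^[s] x - a - L ^ s * (x - a)| ≤ L ^ s * |x - a| * (1 - L ^ s) / 2 →
      |f^[s] x - a| ≤ 2 * (L ^ s * |x - a|) := fun s hs => by
    have h1 := abs_sub_abs_le_abs_sub (f^[s] x - a) (L ^ s * (x - a))
    rw [abs_mul, abs_of_pos (hpow s).1] at h1
    have h2 : 0 ≤ L ^ s * |x - a| := mul_nonneg (hpow s).1.le hd
    nlinarith [(hpow s).1]
  have key : ∀ s : ℕ,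
      |f^[s] x - a - L ^ s * (x - a)| ≤ L ^ s * |x - a| * (1 - L ^ s) / 2 := by
    intro s
    induction s with
    | zero => simp
    | succ s ih =>
      have hu := hupper s ih
      have hp := hpow s
      have hlt : |f^[s] x - a| < δ := by nlinarith
      have hstep := hquad _ hlt
      rw [Function.iterate_succ_apply']
      have hsq : (f^[s] x - a) ^ 2 ≤ (2 * (L ^ s * |x - a|)) ^ 2 := by
        rw [← sq_abs]; gcongr
      have hmain : K * (2 * (L ^ s * |x - a|)) ^ 2 ≤
          (L ^ s) ^ 2 * |x - a| * (L * (1 - L)) / 2 := by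
        have : 0 ≤ (L ^ s) ^ 2 * |x - a| := by positivity
        nlinarith
      calc |f (f^[s] x) - a - L ^ (s + 1) * (x - a)|
          = |(f (f^[s] x) - a - L * (f^[s] x - a)) +
              L * (f^[s] x - a - L ^ s * (x - a))| := by ring_nf
        _ ≤ |f (f^[s] x) - a - L * (f^[s] x - a)| +
              L * |f^[s] x - a - L ^ s * (x - a)| := by
            refine (abs_add_le _ _).trans ?_
            rw [abs_mul L, abs_of_pos hL0]
        _ ≤ (L ^ s) ^ 2 * |x - a| * (L * (1 - L)) / 2 +
              L * (L ^ s * |x - a| * (1 - L ^ s) / 2) := by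
            gcongr
            exact hstep.trans ((mul_le_mul_of_nonneg_left hsq hK.le).trans hmain)
        _ = L ^ (s + 1) * |x - a| * (1 - L ^ (s + 1)) / 2 := by ring
  refine ⟨?_, hupper t (key t)⟩
  have h1 := abs_sub_abs_le_abs_sub (L ^ t * (x - a)) (f^[t] x - a)
  rw [abs_mul, abs_of_pos (hpow t).1, abs_sub_comm (L ^ t * (x - a))] at h1
  have h2 : 0 ≤ L ^ t * |x - a| := mul_nonneg (hpow t).1.le hd
  nlinarith [(hpow t).1, key t]

lemma F_lamOf_div {q : ℕ} {β u : ℝ} (hβ : 0 < β) (hu : 0 < u) :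
    F q β (lamOf u / β) = 1 / q + (1 - 1 / q) * (u / β) := by
  have h := one_sub_exp_neg_pos hu
  rw [F, mul_div_cancel₀ _ hβ.ne', theta_lamOf hu, lamOf]
  field_simp

lemma F_lamOf_div_eq_iff {q : ℕ} {β u : ℝ} (hβ : 0 < β) (hu : 0 < u) :
    F q β (lamOf u / β) = lamOf u / β ↔ lamOf u = β / q + (1 - 1 / q) * u := by
  rw [F_lamOf_div hβ hu, eq_div_iff hβ.ne', eq_comm]
  have : (1 / q + (1 - 1 / q) * (u / β)) * β = β / q + (1 - 1 / q) * u := by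
    field_simp
  rw [this]

lemma exists_lamOf_eq_affine {q : ℕ} (hq : 2 ≤ q) {β : ℝ} (hβ : (q : ℝ) < β) :
    ∃ u, 0 < u ∧ u ≤ β ∧ lamOf u = β / q + (1 - 1 / q) * u := by
  have hq' : (2 : ℝ) ≤ q := by exact_mod_cast hq
  have hk : 1 < β / q := by rwa [one_lt_div (by linarith)]
  have hkβ : β / q ≤ β := div_le_self (by linarith) (by linarith)
  have hr : 0 ≤ 1 - 1 / (q : ℝ) := by
    rw [sub_nonneg, div_le_one (by linarith)]; linarith
  have hc : ContinuousOn
      (fun u : ℝ => u - (β / q + (1 - 1 / q) * u) * (1 - Real.exp (-u)))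
      (Set.Icc (β / q - 1) β) := by fun_prop
  have hmem : (0 : ℝ) ∈ Set.Icc
      ((β / q - 1) - (β / q + (1 - 1 / q) * (β / q - 1)) * (1 - Real.exp (-(β / q - 1))))
      (β - (β / q + (1 - 1 / q) * β) * (1 - Real.exp (-β))) := by
    constructor
    · have h1 := le_mul_one_sub_exp_neg hk
      have h2 := one_sub_exp_neg_pos (u := β / q - 1) (by linarith)
      have h3 : 0 ≤ (1 - 1 / (q : ℝ)) * (β / q - 1) := mul_nonneg hr (by linarith)
      nlinarith
    · have : β / q + (1 - 1 / q) * β = β := by ring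
      rw [this]
      nlinarith [Real.exp_pos (-β)]
  obtain ⟨u, hu, hu0⟩ := intermediate_value_Icc (by linarith) hc hmem
  have hpos : 0 < u := by linarith [hu.1]
  refine ⟨u, hpos, hu.2, ?_⟩
  simp only at hu0
  rw [lamOf, div_eq_iff (one_sub_exp_neg_pos hpos).ne']
  linarith

lemma strictMonoOn_lamOf_sub_div {k : ℝ} (hk : 1 < k) :
    StrictMonoOn (fun u => (lamOf u - k) / u) (Set.Ioi 0) := by
  have hd : ∀ u : ℝ, 0 < u → HasDerivAt (fun u => (lamOf u - k) / u)
      ((((1 - (1 + u) * Real.exp (-u)) / (1 - Real.exp (-u)) ^ 2) * u - (lamOf u - k) * 1)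
        / u ^ 2) u := fun u hu =>
    ((hasDerivAt_lamOf hu).sub_const k).div (hasDerivAt_id u) hu.ne'
  apply strictMonoOn_of_deriv_pos (convex_Ioi 0)
  · exact fun u hu => (hd u hu).continuousAt.continuousWithinAt
  · intro u hu
    rw [interior_Ioi] at hu
    have hu' : 0 < u := hu
    rw [(hd u hu).deriv]
    have h := one_sub_exp_neg_pos hu'
    have hsq := sq_mul_exp_neg_le hu'
    apply div_pos _ (by positivity)
    have h1 : u ^ 2 * Real.exp (-u) / (1 - Real.exp (-u)) ^ 2 ≤ 1 := by
      rwa [div_le_one (by positivity)]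
    have h2 : ((1 - (1 + u) * Real.exp (-u)) / (1 - Real.exp (-u)) ^ 2) * u - (lamOf u - k) * 1
        = k - u ^ 2 * Real.exp (-u) / (1 - Real.exp (-u)) ^ 2 := by
      rw [lamOf]; field_simp; ring
    rw [h2]
    linarith

lemma exists_aFix_eq {q : ℕ} (hq : 2 ≤ q) {β : ℝ} (hβ : (q : ℝ) < β) :
    ∃ u, 0 < u ∧ lamOf u = β / q + (1 - 1 / q) * u ∧ aFix q β = lamOf u / β := by
  obtain ⟨u, hu, huβ, hfix⟩ := exists_lamOf_eq_affine hq hβ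
  refine ⟨u, hu, hfix, ?_⟩
  have hq' : (2 : ℝ) ≤ q := by exact_mod_cast hq
  have hβ0 : 0 < β := by linarith
  have hk : 1 < β / q := by rwa [one_lt_div (by linarith)]
  have hr : 0 < 1 - 1 / (q : ℝ) := by
    rw [sub_pos, div_lt_one (by linarith)]; linarith
  suffices {x : ℝ | x ∈ Set.Ioc (1 / (q : ℝ)) 1 ∧ F q β x = x} = {lamOf u / β} by
    rw [aFix, this, csSup_singleton]
  ext x
  simp only [Set.mem_ofPred_eq, Set.mem_singleton_iff]
  constructor
  · rintro ⟨⟨hx, -⟩, hFx⟩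
    have hlam : 1 < β * x := by
      calc 1 < β / q := hk
        _ = β * (1 / q) := by ring
        _ < β * x := by gcongr
    obtain ⟨w, hw, hwx⟩ := exists_lamOf_eq hlam
    obtain rfl : x = lamOf w / β := by rw [hwx, mul_div_cancel_left₀ _ hβ0.ne']
    have hwfix := (F_lamOf_div_eq_iff hβ0 hw).1 hFx
    have hinj : ∀ v : ℝ, 0 < v → lamOf v = β / q + (1 - 1 / q) * v →
        (lamOf v - β / q) / v = 1 - 1 / q := fun v hv h => by
      rw [h, add_sub_cancel_left, mul_div_cancel_right₀ _ hv.ne']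
    rw [(strictMonoOn_lamOf_sub_div hk).injOn hw hu
      ((hinj w hw hwfix).trans (hinj u hu hfix).symm)]
  · rintro rfl
    refine ⟨⟨?_, ?_⟩, (F_lamOf_div_eq_iff hβ0 hu).2 hfix⟩
    · rw [lt_div_iff₀ hβ0, hfix]
      have : 0 < (1 - 1 / (q : ℝ)) * u := mul_pos hr hu
      have h2 : 1 / (q : ℝ) * β = β / q := by ring
      linarith
    · rw [div_le_one hβ0, hfix]
      have : (1 - 1 / (q : ℝ)) * u ≤ (1 - 1 / (q : ℝ)) * β := by gcongr
      have h2 : β / q + (1 - 1 / (q : ℝ)) * β = β := by ring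
      linarith

lemma contDiffAt_F {q : ℕ} {β u : ℝ} (hβ : 0 < β) (hu : 0 < u) :
    ContDiffAt ℝ 2 (F q β) (lamOf u / β) := by
  have ht : ContDiffAt ℝ 2 (fun x => theta (β * x)) (lamOf u / β) := by
    apply ContDiffAt.comp (g := theta) (f := fun x => β * x)
    · rw [mul_div_cancel₀ _ hβ.ne']
      exact contDiffAt_theta hu
    · fun_prop
  unfold F
  fun_prop

lemma deriv_F_mul {q : ℕ} {β u : ℝ} (hβ : 0 < β) (hu : 0 < u) :
    deriv (F q β) (lamOf u / β) *
      ((1 - (1 + u) * Real.exp (-u)) / (1 - Real.exp (-u)) ^ 2) = 1 - 1 / q := by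
  have hF := ((contDiffAt_F (q := q) hβ hu).differentiableAt (by norm_num)).hasDerivAt
  have hcomp := HasDerivAt.comp u hF ((hasDerivAt_lamOf hu).div_const β)
  have hlin : HasDerivAt (fun w : ℝ => 1 / (q : ℝ) + (1 - 1 / q) * (w / β))
      ((1 - 1 / q) * (1 / β)) u :=
    (((hasDerivAt_id u).div_const β).const_mul _).const_add _
  have heq : (F q β ∘ fun w => lamOf w / β) =ᶠ[nhds u]
      fun w : ℝ => 1 / (q : ℝ) + (1 - 1 / q) * (w / β) := by
    filter_upwards [lt_mem_nhds hu] with w hw using F_lamOf_div hβ hw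
  have := hcomp.unique (hlin.congr_of_eventuallyEq heq)
  rw [← mul_div_assoc, mul_one_div] at this
  exact (div_left_inj' hβ.ne').1 this

lemma deriv_F_aFix_mem_Ioo {q : ℕ} (hq : 2 ≤ q) {β u : ℝ} (hβ : (q : ℝ) < β) (hu : 0 < u)
    (hfix : lamOf u = β / q + (1 - 1 / q) * u) :
    deriv (F q β) (lamOf u / β) ∈ Set.Ioo (0 : ℝ) 1 := by
  have hq' : (2 : ℝ) ≤ q := by exact_mod_cast hq
  have hk : 1 < β / q := by rwa [one_lt_div (by linarith)]
  have hr : 0 < 1 - 1 / (q : ℝ) := by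
    rw [sub_pos, div_lt_one (by linarith)]; linarith
  have hmul := deriv_F_mul (q := q) (β := β) (by linarith) hu
  have hD := deriv_lamOf_pos hu
  have h := one_sub_exp_neg_pos hu
  have hlt : 1 - 1 / (q : ℝ) < (1 - (1 + u) * Real.exp (-u)) / (1 - Real.exp (-u)) ^ 2 := by
    have h1 : u ^ 2 * Real.exp (-u) / (1 - Real.exp (-u)) ^ 2 ≤ 1 := by
      rw [div_le_one (by positivity)]
      exact sq_mul_exp_neg_le hu
    have h2 : ((1 - (1 + u) * Real.exp (-u)) / (1 - Real.exp (-u)) ^ 2) * u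
        = lamOf u - u ^ 2 * Real.exp (-u) / (1 - Real.exp (-u)) ^ 2 := by
      rw [lamOf]; field_simp; ring
    refine lt_of_mul_lt_mul_right ?_ hu.le
    rw [h2, hfix]
    linarith
  constructor
  · exact pos_of_mul_pos_left (hmul ▸ hr) hD.le
  · by_contra! hge
    nlinarith

lemma rpow_bounds_of_cutoff {L γ : ℝ} (hL0 : 0 < L) (hL1 : L < 1) {n T : ℕ} (hn : 1 ≤ n)
    (h1 : (2 * Real.log (1 / L))⁻¹ * Real.log n + γ ≤ T)
    (h2 : (T : ℝ) ≤ (2 * Real.log (1 / L))⁻¹ * Real.log n + γ + 1) :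
    L ^ (γ + 1) / Real.sqrt n ≤ L ^ T ∧ L ^ T ≤ L ^ γ / Real.sqrt n := by
  have hn' : (0 : ℝ) < n := by exact_mod_cast hn
  have hlog : Real.log L < 0 := Real.log_neg hL0 hL1
  have hshift : ∀ s : ℝ,
      L ^ s / Real.sqrt n = L ^ ((2 * Real.log (1 / L))⁻¹ * Real.log n + s) := fun s => by
    have hsqrt : L ^ ((2 * Real.log (1 / L))⁻¹ * Real.log n) = (Real.sqrt n)⁻¹ := by
      rw [Real.rpow_def_of_pos hL0, Real.sqrt_eq_rpow, Real.rpow_def_of_pos hn', ← Real.exp_neg,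
        one_div, Real.log_inv]
      congr 1
      field_simp [hlog.ne]
    rw [Real.rpow_add hL0, hsqrt]
    ring
  rw [hshift, hshift, ← Real.rpow_natCast]
  exact ⟨Real.rpow_le_rpow_of_exponent_ge hL0 hL1.le (by linarith),
    Real.rpow_le_rpow_of_exponent_ge hL0 hL1.le h1⟩

/-- Lemma 4.2: for `T ≈ c(β,q) log n + γ`, the `T`-fold iterate of
`F` from `x₀` near `a` satisfies
`|x₀-a|·C₀/√n - η/√n ≤ |F^T(x₀) - a| ≤ |x₀-a|·C₁/√n + η/√n`. -/
theorem drift_iterate_convergence (q : ℕ) (hq : 2 ≤ q) (β : ℝ) (hβ : (q : ℝ) < β) :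
    ∃ ε₀ : ℝ, 0 < ε₀ ∧ ∀ γ : ℝ, ∃ C₀ C₁ : ℝ, 0 < C₀ ∧ C₀ ≤ C₁ ∧
      ∀ η : ℝ, 0 < η → ∃ N : ℕ, ∀ n : ℕ, N ≤ n →
        ∀ x₀ : ℝ, |x₀ - aFix q β| ≤ ε₀ →
        ∀ T : ℕ, cConst q β * Real.log n + γ ≤ (T : ℝ) →
          (T : ℝ) ≤ cConst q β * Real.log n + γ + 1 →
          |x₀ - aFix q β| * C₀ / Real.sqrt n - η / Real.sqrt n ≤
              |(F q β)^[T] x₀ - aFix q β| ∧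
            |(F q β)^[T] x₀ - aFix q β| ≤
              |x₀ - aFix q β| * C₁ / Real.sqrt n + η / Real.sqrt n := by
  obtain ⟨u, hu, hfix, ha⟩ := exists_aFix_eq hq hβ
  have hβ0 : 0 < β := (Nat.cast_nonneg q).trans_lt hβ
  have hL := deriv_F_aFix_mem_Ioo hq hβ hu hfix
  have hsmooth := contDiffAt_F (q := q) hβ0 hu
  have hFa := (F_lamOf_div_eq_iff hβ0 hu).2 hfix
  rw [← ha] at hL hsmooth hFa
  obtain ⟨ε, hε, hiter⟩ := exists_iterate_sub_bounds hFa hsmooth hL.1 hL.2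
  unfold cConst
  set L := deriv (F q β) (aFix q β)
  refine ⟨ε, hε, fun γ => ⟨L ^ (γ + 1) / 2, 2 * L ^ γ, half_pos (Real.rpow_pos_of_pos hL.1 _),
    ?_, fun η hη => ⟨1, fun n hn x₀ hx T hT1 hT2 => ?_⟩⟩⟩
  · have h1 := Real.rpow_le_rpow_of_exponent_ge hL.1 hL.2.le (show γ ≤ γ + 1 by linarith)
    have h2 := Real.rpow_pos_of_pos hL.1 γ
    linarith
  · obtain ⟨hlo, hhi⟩ := rpow_bounds_of_cutoff hL.1 hL.2 hn hT1 hT2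
    obtain ⟨hdlo, hdhi⟩ := hiter x₀ hx T
    have hd := abs_nonneg (x₀ - aFix q β)
    have hη' : 0 ≤ η / Real.sqrt n := by positivity
    constructor
    · calc |x₀ - aFix q β| * (L ^ (γ + 1) / 2) / Real.sqrt n - η / Real.sqrt n
          ≤ L ^ (γ + 1) / Real.sqrt n * |x₀ - aFix q β| / 2 := by
            rw [sub_le_iff_le_add]
            refine le_trans (le_of_eq ?_) (le_add_of_nonneg_right hη')
            ring
        _ ≤ L ^ T * |x₀ - aFix q β| / 2 := by gcongr
        _ ≤ _ := hdlo
    · calc |(F q β)^[T] x₀ - aFix q β| ≤ 2 * (L ^ T * |x₀ - aFix q β|) := hdhi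
        _ ≤ 2 * (L ^ γ / Real.sqrt n * |x₀ - aFix q β|) := by gcongr
        _ ≤ |x₀ - aFix q β| * (2 * L ^ γ) / Real.sqrt n + η / Real.sqrt n := by
            refine le_trans (le_of_eq ?_) (le_add_of_nonneg_right hη')
            ring
end

section
/- Let q ≥ 2 be an integer and β > q. There exist constants ε₀ > 0, γ₀ > 0, c₁ > 0 and C₁ > 0 such that for every configuration x ∈ Ω with ‖α(x) − m‖_∞ ≤ ε₀, every r ≥ γ₀, and all sufficiently large n: if X′ is the result of one SW step from x, then Pr(‖α(X′) − κ(F(α₁(x)))‖_∞ ≥ r/√n) ≤ e^{−c₁ r} + C₁·r^{−2}, where κ(b) := (b, (1−b)/(q−1), …, (1−b)/(q−1)). -/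
open scoped Classical
open Finset

/-! ### Bernoulli percolation on a finite set of pairs -/

/-- The expectation of `f E` when each pair of `P` is retained in `E` independently with
probability `1 - exp (-b)`. -/
noncomputable def percExp {α : Type*} (b : ℝ) (P : Finset α) (f : Finset α → ℝ) : ℝ :=
  ∑ E ∈ P.powerset,
    ((1 - Real.exp (-b)) ^ E.card * Real.exp (-b) ^ (P.card - E.card)) * f E

section percExp

variable {α : Type*} {b : ℝ} {P : Finset α}

theorem percExp_const (b : ℝ) (P : Finset α) (c : ℝ) : percExp b P (fun _ => c) = c := by
  unfold percExp
  rw [← Finset.sum_mul, Finset.sum_pow_mul_eq_add_pow]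
  simp

theorem percExp_congr {f g : Finset α → ℝ} (h : ∀ E ⊆ P, f E = g E) :
    percExp b P f = percExp b P g := by
  unfold percExp
  refine Finset.sum_congr rfl fun E hE => ?_
  rw [h E (Finset.mem_powerset.1 hE)]

theorem percExp_mono (hb : 0 ≤ b) {f g : Finset α → ℝ} (h : ∀ E ⊆ P, f E ≤ g E) :
    percExp b P f ≤ percExp b P g := by
  unfold percExp
  refine Finset.sum_le_sum fun E hE => mul_le_mul_of_nonneg_left
    (h E (Finset.mem_powerset.1 hE)) ?_
  have : Real.exp (-b) ≤ 1 := Real.exp_le_one_iff.2 (by linarith)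
  have h1 : 0 ≤ 1 - Real.exp (-b) := by linarith
  positivity

theorem percExp_nonneg (hb : 0 ≤ b) {f : Finset α → ℝ} (h : ∀ E ⊆ P, 0 ≤ f E) :
    0 ≤ percExp b P f := by
  have := percExp_mono hb (f := fun _ => 0) h
  rwa [percExp_const] at this

theorem percExp_add (f g : Finset α → ℝ) :
    percExp b P (fun E => f E + g E) = percExp b P f + percExp b P g := by
  simp only [percExp, mul_add, Finset.sum_add_distrib]

theorem percExp_sub (f g : Finset α → ℝ) :
    percExp b P (fun E => f E - g E) = percExp b P f - percExp b P g := by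
  simp only [percExp, mul_sub, Finset.sum_sub_distrib]

theorem percExp_const_mul (c : ℝ) (f : Finset α → ℝ) :
    percExp b P (fun E => c * f E) = c * percExp b P f := by
  simp only [percExp, Finset.mul_sum]
  exact Finset.sum_congr rfl fun E _ => by ring

theorem percExp_sum {ι : Type*} (s : Finset ι) (f : ι → Finset α → ℝ) :
    percExp b P (fun E => ∑ i ∈ s, f i E) = ∑ i ∈ s, percExp b P (f i) := by
  simp only [percExp, Finset.mul_sum]
  exact Finset.sum_comm

/-- Fubini for percolation on a disjoint union. -/
theorem percExp_union [DecidableEq α] (P₁ P₂ : Finset α) (h : Disjoint P₁ P₂) (f : Finset α → ℝ) :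
    percExp b (P₁ ∪ P₂) f = percExp b P₁ (fun E₁ => percExp b P₂ (fun E₂ => f (E₁ ∪ E₂))) := by
  unfold percExp
  simp_rw [Finset.mul_sum]
  rw [Finset.sum_sigma']
  symm
  refine Finset.sum_bij' (fun x _ => x.1 ∪ x.2) (fun E _ => ⟨E ∩ P₁, E ∩ P₂⟩) ?_ ?_ ?_ ?_ ?_
  · rintro ⟨E₁, E₂⟩ hE
    simp only [Finset.mem_sigma, Finset.mem_powerset] at hE ⊢
    exact Finset.union_subset_union hE.1 hE.2
  · intro E hE
    simp only [Finset.mem_sigma, Finset.mem_powerset]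
    exact ⟨Finset.inter_subset_right, Finset.inter_subset_right⟩
  · rintro ⟨E₁, E₂⟩ hE
    simp only [Finset.mem_sigma, Finset.mem_powerset] at hE
    have h1 : (E₁ ∪ E₂) ∩ P₁ = E₁ := by
      ext e
      simp only [Finset.mem_inter, Finset.mem_union]
      have := @hE.1 e
      have := @hE.2 e
      have : e ∈ P₁ → e ∉ P₂ := fun h' => Finset.disjoint_left.1 h h'
      tauto
    have h2 : (E₁ ∪ E₂) ∩ P₂ = E₂ := by
      ext e
      simp only [Finset.mem_inter, Finset.mem_union]
      have := @hE.1 e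
      have := @hE.2 e
      have : e ∈ P₁ → e ∉ P₂ := fun h' => Finset.disjoint_left.1 h h'
      tauto
    simp only [h1, h2]
  · intro E hE
    rw [Finset.mem_powerset] at hE
    rw [← Finset.inter_union_distrib_left, Finset.inter_eq_left.2 hE]
  · rintro ⟨E₁, E₂⟩ hE
    simp only [Finset.mem_sigma, Finset.mem_powerset] at hE
    have hd : Disjoint E₁ E₂ := Finset.disjoint_of_subset_left hE.1
      (Finset.disjoint_of_subset_right hE.2 h)
    simp only
    rw [Finset.card_union_of_disjoint hd, Finset.card_union_of_disjoint h]
    have e1 := Finset.card_le_card hE.1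
    have e2 := Finset.card_le_card hE.2
    rw [show P₁.card + P₂.card - (E₁.card + E₂.card)
      = (P₁.card - E₁.card) + (P₂.card - E₂.card) by omega, pow_add, pow_add]
    ring

/-- The probability that no pair of `Q` is retained. -/
theorem percExp_disjoint [DecidableEq α] (Q : Finset α) (hQ : Q ⊆ P) :
    percExp b P (fun E => if Disjoint E Q then 1 else 0) = Real.exp (-b) ^ Q.card := by
  have hP : P = Q ∪ (P \ Q) := by rw [Finset.union_sdiff_of_subset hQ]
  rw [hP, percExp_union _ _ Finset.disjoint_sdiff]
  have : ∀ E₁ ⊆ Q, percExp b (P \ Q) (fun E₂ => if Disjoint (E₁ ∪ E₂) Q then (1 : ℝ) else 0)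
      = if E₁ = ∅ then 1 else 0 := by
    intro E₁ h1
    rw [← percExp_const b (P \ Q) (if E₁ = ∅ then (1 : ℝ) else 0)]
    refine percExp_congr fun E₂ h2 => ?_
    congr 1
    rw [Finset.disjoint_union_left, eq_iff_iff]
    constructor
    · rintro ⟨h3, -⟩
      exact Finset.disjoint_self_iff_empty _ |>.1 (Finset.disjoint_of_subset_right h1 h3)
    · rintro rfl
      exact ⟨Finset.disjoint_empty_left _,
        Finset.disjoint_of_subset_left h2 Finset.sdiff_disjoint⟩
  rw [percExp_congr this]
  unfold percExp
  rw [Finset.sum_eq_single ∅]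
  · simp
  · intro E _ hE
    simp [hE]
  · intro hE
    simp at hE

end percExp

/-! ### The vertices reached from a set of seeds -/

/-- The vertices joined to a vertex of `I` by a path of pairs in `E`. -/
noncomputable def reachSet {n : ℕ} (E : Finset (Fin n × Fin n)) (I : Finset (Fin n)) :
    Finset (Fin n) :=
  univ.filter (fun u => ∃ v ∈ I, (graphOf E).Reachable v u)

/-- The vertices of spin `j`. -/
def spinClass {n q : ℕ} (x : Conf n q) (j : Fin q) : Finset (Fin n) :=
  univ.filter (fun v => x v = j)

theorem mem_reachSet {n : ℕ} {E : Finset (Fin n × Fin n)} {I : Finset (Fin n)} {u : Fin n} :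
    u ∈ reachSet E I ↔ ∃ v ∈ I, (graphOf E).Reachable v u := by
  simp [reachSet]

theorem mem_spinClass {n q : ℕ} {x : Conf n q} {j : Fin q} {v : Fin n} :
    v ∈ spinClass x j ↔ x v = j := by
  simp [spinClass]

theorem mem_monoPairs {n q : ℕ} {x : Conf n q} {e : Fin n × Fin n} :
    e ∈ monoPairs x ↔ e.1 < e.2 ∧ x e.1 = x e.2 := by
  simp [monoPairs]

theorem graphOf_adj {n : ℕ} {E : Finset (Fin n × Fin n)} {u v : Fin n} :
    (graphOf E).Adj u v ↔ u ≠ v ∧ ((u, v) ∈ E ∨ (v, u) ∈ E) := by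
  simp [graphOf]

theorem graphOf_mono {n : ℕ} {E E' : Finset (Fin n × Fin n)} (h : E ⊆ E') :
    graphOf E ≤ graphOf E' := by
  intro u v
  rw [graphOf_adj, graphOf_adj]
  rintro ⟨h1, h2⟩
  exact ⟨h1, h2.imp (@h _) (@h _)⟩

theorem subset_reachSet {n : ℕ} (E : Finset (Fin n × Fin n)) (I : Finset (Fin n)) :
    I ⊆ reachSet E I := fun v hv => mem_reachSet.2 ⟨v, hv, SimpleGraph.Reachable.refl _⟩

/-- A set containing the seeds and closed under adjacency contains everything reached. -/
theorem reachSet_subset {n : ℕ} {E : Finset (Fin n × Fin n)} {I : Finset (Fin n)}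
    {s : Set (Fin n)} (hI : ∀ v ∈ I, v ∈ s)
    (hs : ∀ u v, (graphOf E).Adj u v → u ∈ s → v ∈ s) {u : Fin n} (hu : u ∈ reachSet E I) :
    u ∈ s := by
  obtain ⟨v, hv, ⟨p⟩⟩ := mem_reachSet.1 hu
  have hv' := hI v hv
  clear hv hu
  induction p with
  | nil => exact hv'
  | cons h _ ih => exact ih (hs _ _ h hv')

theorem reachSet_mono {n : ℕ} {E E' : Finset (Fin n × Fin n)} (h : E ⊆ E')
    (I : Finset (Fin n)) : reachSet E I ⊆ reachSet E' I := by
  intro u hu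
  obtain ⟨v, hv, hp⟩ := mem_reachSet.1 hu
  exact mem_reachSet.2 ⟨v, hv, hp.mono (graphOf_mono h)⟩

theorem reachSet_adj {n : ℕ} {E : Finset (Fin n × Fin n)} {I : Finset (Fin n)} {u v : Fin n}
    (hu : u ∈ reachSet E I) (h : (graphOf E).Adj u v) : v ∈ reachSet E I := by
  obtain ⟨w, hw, hp⟩ := mem_reachSet.1 hu
  exact mem_reachSet.2 ⟨w, hw, hp.trans h.reachable⟩

theorem reachSet_subset_spinClass {n q : ℕ} {x : Conf n q} {j : Fin q}
    {E : Finset (Fin n × Fin n)} (hE : E ⊆ monoPairs x) {I : Finset (Fin n)}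
    (hI : I ⊆ spinClass x j) : reachSet E I ⊆ spinClass x j := by
  intro u hu
  refine reachSet_subset (s := {v | v ∈ spinClass x j}) (fun v hv => hI hv) ?_ hu
  intro u v h
  simp only [Set.mem_ofPred_eq, mem_spinClass]
  rintro rfl
  rw [graphOf_adj] at h
  rcases h.2 with h | h
  · exact (mem_monoPairs.1 (hE h)).2.symm
  · exact (mem_monoPairs.1 (hE h)).2

/-- The pairs of `P` joining `A` and `C`. -/
def crossPairs {n : ℕ} (P : Finset (Fin n × Fin n)) (A C : Finset (Fin n)) :
    Finset (Fin n × Fin n) :=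
  P.filter (fun e => (e.1 ∈ A ∧ e.2 ∈ C) ∨ (e.1 ∈ C ∧ e.2 ∈ A))

theorem card_crossPairs {n q : ℕ} (x : Conf n q) (j : Fin q) {A C : Finset (Fin n)}
    (hA : A ⊆ spinClass x j) (hC : C ⊆ spinClass x j) (h : Disjoint C A) :
    (crossPairs (monoPairs x) A C).card = A.card * C.card := by
  rw [← Finset.card_product]
  symm
  have hne : ∀ a ∈ A, ∀ c ∈ C, a ≠ c := fun a ha c hc hac =>
    Finset.disjoint_left.1 h hc (hac ▸ ha)
  refine Finset.card_bij (fun e _ => if e.1 < e.2 then e else (e.2, e.1)) ?_ ?_ ?_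
  · rintro ⟨a, c⟩ he
    rw [Finset.mem_product] at he
    have h1 := mem_spinClass.1 (hA he.1)
    have h2 := mem_spinClass.1 (hC he.2)
    have h3 := hne a he.1 c he.2
    simp only at h1 h2 he ⊢
    unfold crossPairs
    split_ifs with hlt
    · simp [mem_monoPairs, hlt, h1, h2, he.1, he.2]
    · have : c < a := lt_of_le_of_ne (not_lt.1 hlt) h3.symm
      simp [mem_monoPairs, this, h1, h2, he.1, he.2]
  · rintro ⟨a, c⟩ he ⟨a', c'⟩ he' hh
    rw [Finset.mem_product] at he he'
    simp only at he he' hh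
    split_ifs at hh with h1 h2 h2
    · exact hh
    · simp only [Prod.mk.injEq] at hh
      exact absurd hh.1 (hne a he.1 c' he'.2)
    · simp only [Prod.mk.injEq] at hh
      exact absurd hh.2 (hne a he.1 c' he'.2)
    · simp only [Prod.mk.injEq] at hh ⊢
      exact ⟨hh.2, hh.1⟩
  · rintro ⟨u, v⟩ he
    simp only [crossPairs, Finset.mem_filter, mem_monoPairs] at he
    rcases he.2 with h1 | h1
    · exact ⟨(u, v), Finset.mem_product.2 h1, by simp [he.1.1]⟩
    · exact ⟨(v, u), Finset.mem_product.2 ⟨h1.2, h1.1⟩, by simp [he.1.1.le]⟩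

/-- Exploring from seeds `I` while avoiding `A`: an exact identity. -/
theorem percExp_avoid {n q : ℕ} (b : ℝ) (x : Conf n q) (j : Fin q) {A I : Finset (Fin n)}
    (hA : A ⊆ spinClass x j) (hI : I ⊆ spinClass x j) (hAI : Disjoint A I) :
    percExp b (monoPairs x) (fun E => if Disjoint (reachSet E I) A then
      Real.exp (b * (A.card * (reachSet E I).card)) else 0) = 1 := by
  set P := monoPairs x with hP
  set P₁ := P.filter (fun e => ¬ (e.1 ∈ A ∨ e.2 ∈ A)) with hP₁
  set P₂ := P.filter (fun e => e.1 ∈ A ∨ e.2 ∈ A) with hP₂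
  have hu : P = P₁ ∪ P₂ := by
    rw [Finset.union_comm, hP₁, hP₂, Finset.filter_union_filter_not_eq]
  have hd : Disjoint P₁ P₂ := (Finset.disjoint_filter_filter_not _ _ _).symm
  have key : ∀ E₁ ⊆ P₁, percExp b P₂ (fun E₂ => if Disjoint (reachSet (E₁ ∪ E₂) I) A then
      Real.exp (b * (A.card * (reachSet (E₁ ∪ E₂) I).card)) else 0) = 1 := by
    intro E₁ h1
    set C := reachSet E₁ I with hC
    have hCS : C ⊆ spinClass x j :=
      reachSet_subset_spinClass (h1.trans (Finset.filter_subset _ _)) hI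
    have hCA : Disjoint C A := by
      rw [Finset.disjoint_left]
      intro u hu
      refine reachSet_subset (s := {v | v ∉ A}) (fun v hv hvA =>
        Finset.disjoint_left.1 hAI hvA hv) ?_ hu
      intro u v h _ hvA
      rw [graphOf_adj] at h
      rcases h.2 with h | h
      · exact (Finset.mem_filter.1 (h1 h)).2 (Or.inr hvA)
      · exact (Finset.mem_filter.1 (h1 h)).2 (Or.inl hvA)
    set Q := crossPairs P A C with hQ
    have hQP : Q ⊆ P₂ := by
      intro e he
      simp only [hQ, crossPairs, Finset.mem_filter] at he
      rw [hP₂, Finset.mem_filter]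
      exact ⟨he.1, by tauto⟩
    have e1 : ∀ E₂ ⊆ P₂, (if Disjoint (reachSet (E₁ ∪ E₂) I) A then
        Real.exp (b * (A.card * (reachSet (E₁ ∪ E₂) I).card)) else 0)
        = Real.exp (b * (A.card * C.card)) * (if Disjoint E₂ Q then 1 else 0) := by
      intro E₂ h2
      by_cases hdis : Disjoint E₂ Q
      · have hR : reachSet (E₁ ∪ E₂) I = C := by
          apply subset_antisymm _ (reachSet_mono Finset.subset_union_left I)
          intro u hu
          refine reachSet_subset (s := {v | v ∈ C}) (fun v hv => subset_reachSet _ _ hv) ?_ hu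
          intro u v h huC
          have huA : u ∉ A := Finset.disjoint_left.1 hCA huC
          rw [graphOf_adj] at h
          simp only [Finset.mem_union, Set.mem_ofPred_eq] at h huC ⊢
          have hin : (u, v) ∈ E₁ ∨ (v, u) ∈ E₁ → v ∈ C := fun hh =>
            reachSet_adj huC (graphOf_adj.2 ⟨h.1, hh⟩)
          have hout1 : (u, v) ∉ E₂ := by
            intro he
            have h3 := Finset.mem_filter.1 (h2 he)
            refine Finset.disjoint_left.1 hdis he ?_
            simp only [hQ, crossPairs, Finset.mem_filter]
            have := h3.2.resolve_left huA
            exact ⟨h3.1, Or.inr ⟨huC, this⟩⟩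
          have hout2 : (v, u) ∉ E₂ := by
            intro he
            have h3 := Finset.mem_filter.1 (h2 he)
            refine Finset.disjoint_left.1 hdis he ?_
            simp only [hQ, crossPairs, Finset.mem_filter]
            have := h3.2.resolve_right huA
            exact ⟨h3.1, Or.inl ⟨this, huC⟩⟩
          tauto
        rw [hR, if_pos hCA, if_pos hdis, mul_one]
      · have hR : ¬ Disjoint (reachSet (E₁ ∪ E₂) I) A := by
          intro hdA
          rw [Finset.not_disjoint_iff] at hdis
          obtain ⟨⟨u, v⟩, he, heQ⟩ := hdis
          simp only [hQ, crossPairs, Finset.mem_filter] at heQ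
          have hadj : (graphOf (E₁ ∪ E₂)).Adj u v := graphOf_adj.2
            ⟨(mem_monoPairs.1 heQ.1).1.ne, Or.inl (Finset.mem_union_right _ he)⟩
          rcases heQ.2 with h3 | h3
          · exact Finset.disjoint_left.1 hdA (reachSet_adj
              (reachSet_mono Finset.subset_union_left I h3.2) hadj.symm) h3.1
          · exact Finset.disjoint_left.1 hdA (reachSet_adj
              (reachSet_mono Finset.subset_union_left I h3.1) hadj) h3.2
        rw [if_neg hR, if_neg hdis, mul_zero]
    rw [percExp_congr e1, percExp_const_mul, percExp_disjoint Q hQP,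
      card_crossPairs x j hA hCS hCA, ← Real.exp_nat_mul, ← Real.exp_add]
    push_cast
    rw [Real.exp_eq_one_iff]
    ring
  rw [hu, percExp_union _ _ hd, percExp_congr key, percExp_const]

/-- Exact binomial moments of the number of vertices not reached from the seeds. -/
theorem percExp_choose {n q : ℕ} (b : ℝ) (x : Conf n q) (j : Fin q) {I : Finset (Fin n)}
    (hI : I ⊆ spinClass x j) (i : ℕ) :
    percExp b (monoPairs x) (fun E =>
      (((spinClass x j).card - (reachSet E I).card).choose i : ℝ)
        * Real.exp (b * (i * (reachSet E I).card)))
      = (((spinClass x j).card - I.card).choose i : ℝ) := by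
  set S := spinClass x j with hS
  have h1 : ((S.card - I.card).choose i : ℝ) = ∑ A ∈ (S \ I).powersetCard i,
      percExp b (monoPairs x) (fun E => if Disjoint (reachSet E I) A then
        Real.exp (b * (A.card * (reachSet E I).card)) else 0) := by
    rw [Finset.sum_congr rfl (g := fun _ => (1 : ℝ)), Finset.sum_const, Finset.card_powersetCard,
      Finset.card_sdiff_of_subset hI]
    · simp
    · intro A hA
      rw [Finset.mem_powersetCard, Finset.subset_sdiff] at hA
      exact percExp_avoid b x j hA.1.1 hI hA.1.2
  rw [h1, ← percExp_sum]
  refine percExp_congr fun E hE => ?_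
  have hR := reachSet_subset_spinClass hE hI
  rw [← Finset.sum_filter, Finset.sum_congr rfl
    (g := fun _ => Real.exp (b * (i * (reachSet E I).card))), Finset.sum_const, nsmul_eq_mul]
  · congr 1
    norm_cast
    rw [← Finset.card_sdiff_of_subset hR, ← Finset.card_powersetCard]
    congr 1
    ext A
    simp only [Finset.mem_powersetCard, Finset.mem_filter, Finset.subset_sdiff]
    constructor
    · rintro ⟨⟨h2, h3⟩, h4⟩
      exact ⟨⟨⟨h2, Finset.disjoint_of_subset_right (subset_reachSet E I) h3⟩, h4⟩, h3.symm⟩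
    · rintro ⟨⟨⟨h2, h3⟩, h4⟩, h5⟩
      exact ⟨⟨h2, h5.symm⟩, h4⟩
  · intro A hA
    rw [Finset.mem_filter, Finset.mem_powersetCard] at hA
    rw [hA.1.2]

/-! ### The survival probability `theta` and the drift function -/

theorem exp_neg_le_inv {y : ℝ} (hy : 0 ≤ y) : Real.exp (-y) ≤ 1 / (1 + y) := by
  rw [Real.exp_neg, ← one_div]
  exact one_div_le_one_div_of_le (by linarith) (by linarith [Real.add_one_le_exp y])

theorem exp_neg_mul_lt {lam z : ℝ} (hl : 0 < lam) (hz : 0 < z) (h : lam * z < lam - 1) :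
    Real.exp (-lam * z) < 1 - z := by
  have h1 := exp_neg_le_inv (y := lam * z) (by positivity)
  rw [← neg_mul] at h1
  refine lt_of_le_of_lt h1 ?_
  rw [div_lt_iff₀ (by positivity)]
  nlinarith

theorem exp_neg_mul_concave {lam x y t : ℝ} (h0 : 0 ≤ t) (h1 : t ≤ 1) :
    t * (1 - x - Real.exp (-lam * x)) + (1 - t) * (1 - y - Real.exp (-lam * y))
      ≤ 1 - (t * x + (1 - t) * y) - Real.exp (-lam * (t * x + (1 - t) * y)) := by
  have := convexOn_exp.2 (Set.mem_univ (-lam * x)) (Set.mem_univ (-lam * y)) h0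
    (by linarith : 0 ≤ 1 - t) (by ring)
  simp only [smul_eq_mul] at this
  rw [show -lam * (t * x + (1 - t) * y) = t * (-lam * x) + (1 - t) * (-lam * y) by ring]
  linarith

theorem root_unique_of_lt {lam x y : ℝ} (hl : 0 < lam) (hx : 0 < x) (hxy : x < y)
    (h1 : Real.exp (-lam * x) = 1 - x) (h2 : Real.exp (-lam * y) = 1 - y) : False := by
  have hy : 0 < y := hx.trans hxy
  have ht : 0 < x / y := by positivity
  have ht1 : x / y < 1 := (div_lt_one hy).2 hxy
  have hne : -lam * y ≠ 0 := by
    have := mul_pos hl hy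
    nlinarith
  have := strictConvexOn_exp.2 (Set.mem_univ (-lam * y)) (Set.mem_univ 0) hne ht
    (by linarith : 0 < 1 - x / y) (by ring)
  simp only [smul_eq_mul, mul_zero, add_zero, Real.exp_zero, mul_one] at this
  rw [h2, show x / y * (-lam * y) = -lam * x by field_simp, h1] at this
  have h3 : x / y * (1 - y) = x / y - x := by field_simp
  linarith

theorem theta_spec {lam : ℝ} (hl : 1 < lam) :
    theta lam ∈ Set.Ioo (0 : ℝ) 1 ∧ Real.exp (-lam * theta lam) = 1 - theta lam := by
  have hl0 : 0 < lam := by linarith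
  obtain ⟨x, hx, hxr⟩ : ∃ x ∈ Set.Ioo (0 : ℝ) 1, Real.exp (-lam * x) = 1 - x := by
    set z := (lam - 1) / (2 * lam) with hz
    have hz0 : 0 < z := div_pos (by linarith) (by linarith)
    have hzl : lam * z < lam - 1 := by
      rw [hz, show lam * ((lam - 1) / (2 * lam)) = (lam - 1) / 2 by field_simp]
      linarith
    have hz1 : z < 1 := by nlinarith
    have hg := exp_neg_mul_lt hl0 hz0 hzl
    have hc : ContinuousOn (fun z : ℝ => 1 - z - Real.exp (-lam * z)) (Set.Icc z 1) := by
      fun_prop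
    have := intermediate_value_Icc' hz1.le hc
    have h0 : (0 : ℝ) ∈ Set.Icc (1 - 1 - Real.exp (-lam * 1)) (1 - z - Real.exp (-lam * z)) :=
      ⟨by linarith [Real.exp_pos (-lam * 1)], by linarith⟩
    obtain ⟨x, hx, hx0⟩ := this h0
    simp only at hx0
    refine ⟨x, ⟨lt_of_lt_of_le hz0 hx.1, ?_⟩, by linarith⟩
    linarith [Real.exp_pos (-lam * x)]
  have hset : {x : ℝ | x ∈ Set.Ioo (0 : ℝ) 1 ∧ Real.exp (-lam * x) = 1 - x} = {x} := by
    ext y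
    constructor
    · rintro ⟨hy, hyr⟩
      rcases lt_trichotomy x y with h | h | h
      · exact (root_unique_of_lt hl0 hx.1 h hxr hyr).elim
      · exact h.symm
      · exact (root_unique_of_lt hl0 hy.1 h hyr hxr).elim
    · rintro rfl
      exact ⟨hx, hxr⟩
  have : theta lam = x := by
    unfold theta
    rw [if_neg (not_le.2 hl), hset, csSup_singleton]
  rw [this]
  exact ⟨hx, hxr⟩

theorem theta_nonneg_le_one (lam : ℝ) : 0 ≤ theta lam ∧ theta lam ≤ 1 := by
  rcases le_or_gt lam 1 with h | h
  · simp [theta, h]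
  · exact ⟨(theta_spec h).1.1.le, (theta_spec h).1.2.le⟩

theorem lt_theta {lam w : ℝ} (hl : 1 < lam) (hw : 0 < w)
    (h : 0 < 1 - w - Real.exp (-lam * w)) : w < theta lam := by
  obtain ⟨⟨h0, h1⟩, hr⟩ := theta_spec hl
  by_contra! hle
  have h2 := exp_neg_mul_concave (lam := lam) (x := w) (y := 0) (t := theta lam / w)
    (by positivity) ((div_le_one hw).2 hle)
  have h3 : theta lam / w * w + (1 - theta lam / w) * 0 = theta lam := by field_simp; ring
  rw [h3, hr] at h2
  simp only [mul_zero, Real.exp_zero] at h2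
  have := mul_pos (div_pos h0 hw) h
  linarith

/-- Away from zero, the defect in the equation for `theta` controls the distance to `theta`. -/
theorem mul_abs_sub_theta_le {lam w z : ℝ} (hl : 1 < lam) (hw : 0 < w)
    (h : 0 < 1 - w - Real.exp (-lam * w)) (hz : w ≤ z) :
    (1 - w - Real.exp (-lam * w)) * |z - theta lam| ≤ |1 - z - Real.exp (-lam * z)| := by
  have hlt := lt_theta hl hw h
  obtain ⟨⟨h0, h1⟩, hr⟩ := theta_spec hl
  set g := 1 - w - Real.exp (-lam * w) with hg
  set θ := theta lam
  rcases le_or_gt z θ with hzt | hzt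
  · rw [abs_of_nonpos (by linarith)]
    refine le_trans ?_ (le_abs_self _)
    have hd : 0 < θ - w := by linarith
    have h2 := exp_neg_mul_concave (lam := lam) (x := w) (y := θ) (t := (θ - z) / (θ - w))
      (div_nonneg (by linarith) hd.le) ((div_le_one hd).2 (by linarith))
    have h3 : (θ - z) / (θ - w) * w + (1 - (θ - z) / (θ - w)) * θ = z := by
      field_simp
      ring
    rw [h3, hr, ← hg] at h2
    have h4 : θ - z ≤ (θ - z) / (θ - w) := by
      rw [le_div_iff₀ hd]
      nlinarith
    nlinarith
  · rw [abs_of_pos (by linarith)]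
    refine le_trans ?_ (neg_le_abs _)
    have hd : 0 < z - w := by linarith
    have h2 := exp_neg_mul_concave (lam := lam) (x := w) (y := z) (t := (z - θ) / (z - w))
      (div_nonneg (by linarith) hd.le) ((div_le_one hd).2 (by linarith))
    have h3 : (z - θ) / (z - w) * w + (1 - (z - θ) / (z - w)) * z = θ := by
      field_simp
      ring
    rw [h3, hr, ← hg] at h2
    set G := 1 - z - Real.exp (-lam * z)
    have h4 : (1 - (z - θ) / (z - w)) = (θ - w) / (z - w) := by
      field_simp
      ring
    rw [h4] at h2
    have h5 : (z - θ) * g + (θ - w) * G ≤ 0 := by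
      have h6 : (z - θ) / (z - w) * g + (θ - w) / (z - w) * G
        = ((z - θ) * g + (θ - w) * G) / (z - w) := by ring
      rw [h6] at h2
      by_contra! hpos
      have := div_pos hpos hd
      linarith
    have hG : G ≤ 0 := by
      by_contra! hpos
      have := mul_pos (sub_pos.2 hlt) hpos
      have := mul_pos (sub_pos.2 hzt) h
      linarith
    nlinarith

/-- Uniform exponential gap below the root. -/
theorem exists_exp_gap {lam₀ z₁ : ℝ} (hz : 0 < z₁) (h : Real.exp (-lam₀ * z₁) < 1 - z₁) :
    ∃ g : ℝ, 0 < g ∧ g < 1 / 2 ∧ ∀ lam, lam₀ ≤ lam → ∀ z, 0 ≤ z → z ≤ z₁ →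
      Real.exp (-(lam - g) * z) ≤ 1 - z / (1 - g) := by
  have hcont : ContinuousAt (fun g : ℝ => 1 - z₁ / (1 - g) - Real.exp (-(lam₀ - g) * z₁)) 0 := by
    have : ContinuousAt (fun g : ℝ => z₁ / (1 - g)) 0 :=
      continuousAt_const.div (by fun_prop) (by norm_num)
    fun_prop
  have hev := hcont.eventually (lt_mem_nhds (a := 0) (by
    rw [neg_mul] at h
    simpa using h))
  have hev' : ∀ᶠ g : ℝ in nhdsWithin 0 (Set.Ioi 0),
      (0 < 1 - z₁ / (1 - g) - Real.exp (-(lam₀ - g) * z₁)) ∧ 0 < g ∧ g < 1 / 2 :=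
    (hev.filter_mono nhdsWithin_le_nhds).and ((eventually_mem_nhdsWithin).and
      ((gt_mem_nhds (by norm_num : (0 : ℝ) < 1 / 2)).filter_mono nhdsWithin_le_nhds))
  obtain ⟨g, h1, h2, h3⟩ := hev'.exists
  refine ⟨g, h2, h3, fun lam hl z hz0 hzz => ?_⟩
  have hexp : Real.exp (-(lam - g) * z₁) ≤ 1 - z₁ / (1 - g) := by
    refine le_trans (Real.exp_le_exp.2 ?_) (sub_pos.1 h1).le
    nlinarith
  have hc := convexOn_exp.2 (Set.mem_univ (-(lam - g) * z₁)) (Set.mem_univ 0)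
    (by positivity : 0 ≤ z / z₁) (by linarith [(div_le_one hz).2 hzz] : 0 ≤ 1 - z / z₁) (by ring)
  simp only [smul_eq_mul, mul_zero, add_zero, Real.exp_zero, mul_one] at hc
  rw [show z / z₁ * (-(lam - g) * z₁) = -(lam - g) * z by field_simp] at hc
  have h4 := mul_le_mul_of_nonneg_left hexp (by positivity : 0 ≤ z / z₁)
  have h5 : z / z₁ * (1 - z₁ / (1 - g)) = z / z₁ - z / (1 - g) := by
    field_simp
  linarith

/-- The complement of the giant component is subcritical. -/
theorem mul_one_sub_theta_lt_one {lam : ℝ} (hl : 1 < lam) : lam * (1 - theta lam) < 1 := by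
  obtain ⟨⟨h0, h1⟩, hr⟩ := theta_spec hl
  have hu : 0 < lam * theta lam := mul_pos (by linarith) h0
  have h2 := Real.add_one_lt_exp hu.ne'
  have h3 : Real.exp (lam * theta lam) * (1 - theta lam) = 1 := by
    rw [← hr, ← Real.exp_add]
    simp
  have h4 : 0 < 1 - theta lam := by linarith
  have h5 := mul_lt_mul_of_pos_right h2 h4
  rw [h3] at h5
  by_contra! h6
  nlinarith

theorem fixed_point_subcritical {q : ℕ} (hq : 2 ≤ q) {β y : ℝ} (hβ : (q : ℝ) < β)
    (hy : 1 / (q : ℝ) < y) (hF : F q β y = y) :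
    1 < β * y ∧ β * ((1 - y) / ((q : ℝ) - 1)) < 1 := by
  have hq' : (2 : ℝ) ≤ q := by exact_mod_cast hq
  have h1 : 1 < β * y := by
    rw [div_lt_iff₀ (by linarith)] at hy
    have : 0 < y := by
      by_contra! h
      nlinarith
    nlinarith
  refine ⟨h1, ?_⟩
  have h2 := mul_one_sub_theta_lt_one h1
  unfold F at hF
  set θ := theta (β * y)
  have h3 : 1 + ((q : ℝ) - 1) * θ * y = q * y := by
    have : (q : ℝ) * (1 / q + (1 - 1 / q) * θ * y) = 1 + ((q : ℝ) - 1) * θ * y := by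
      field_simp
    rw [← this, hF]
  have h4 : (1 - y) / ((q : ℝ) - 1) = y * (1 - θ) := by
    rw [div_eq_iff (by linarith)]
    linarith
  rw [h4]
  linarith

theorem aFix_spec {q : ℕ} (hq : 2 ≤ q) {β : ℝ} (hβ : (q : ℝ) < β) :
    aFix q β = 0 ∨ (1 < β * aFix q β ∧ β * ((1 - aFix q β) / ((q : ℝ) - 1)) < 1) := by
  have hq' : (2 : ℝ) ≤ q := by exact_mod_cast hq
  rcases Set.eq_empty_or_nonempty {x : ℝ | x ∈ Set.Ioc (1 / (q : ℝ)) 1 ∧ F q β x = x}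
    with h | ⟨y, hy⟩
  · left
    rw [aFix, h, Real.sSup_empty]
  · right
    have hle : y ≤ aFix q β := le_csSup ⟨1, fun z hz => hz.1.2⟩ hy
    obtain ⟨h1, h2⟩ := fixed_point_subcritical hq hβ hy.1.1 hy.2
    constructor
    · nlinarith
    · refine lt_of_le_of_lt (mul_le_mul_of_nonneg_left ?_ (by linarith)) h2
      exact div_le_div_of_nonneg_right (by linarith) (by linarith)

/-! ### Estimates for the number of vertices reached -/

theorem card_reachSet_le {n q : ℕ} {x : Conf n q} {j : Fin q} {E : Finset (Fin n × Fin n)}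
    (hE : E ⊆ monoPairs x) {I : Finset (Fin n)} (hI : I ⊆ spinClass x j) :
    (reachSet E I).card ≤ (spinClass x j).card :=
  Finset.card_le_card (reachSet_subset_spinClass hE hI)

theorem percExp_reach_sq_le {n q : ℕ} (b : ℝ) (hb : 0 ≤ b) (x : Conf n q) (j : Fin q)
    {I : Finset (Fin n)} (hI : I ⊆ spinClass x j) :
    percExp b (monoPairs x) (fun E =>
      ((((spinClass x j).card : ℝ) - (reachSet E I).card) * Real.exp (b * (reachSet E I).card)
        - (spinClass x j).card) ^ 2)
      ≤ (I.card : ℝ) ^ 2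
        + (spinClass x j).card * Real.exp (2 * (b * (spinClass x j).card)) := by
  set k := (spinClass x j).card with hk
  have hmk : I.card ≤ k := Finset.card_le_card hI
  have h1 := percExp_choose b x j hI 1
  have h2 := percExp_choose b x j hI 2
  rw [← hk] at h1 h2
  rw [Nat.cast_choose_two, Nat.cast_sub hmk] at h2
  rw [Nat.choose_one_right, Nat.cast_sub hmk] at h1
  have key : ∀ E ⊆ monoPairs x,
      (((k : ℝ) - (reachSet E I).card) * Real.exp (b * (reachSet E I).card) - k) ^ 2
      ≤ ((2 * (((k - (reachSet E I).card).choose 2 : ℝ)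
            * Real.exp (b * ((2 : ℕ) * (reachSet E I).card)))
        - 2 * k * (((k - (reachSet E I).card).choose 1 : ℝ)
            * Real.exp (b * ((1 : ℕ) * (reachSet E I).card))))
        + (k * Real.exp (2 * (b * k)) + (k : ℝ) ^ 2)) := by
    intro E hE
    have hZ := card_reachSet_le hE hI
    rw [← hk] at hZ
    set Z := (reachSet E I).card
    rw [Nat.cast_choose_two, Nat.choose_one_right, Nat.cast_sub hZ]
    have e2 : Real.exp (b * ((2 : ℕ) * Z)) = Real.exp (b * Z) ^ 2 := by
      rw [← Real.exp_nat_mul]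
      congr 1
      push_cast
      ring
    have e1 : Real.exp (b * ((1 : ℕ) * Z)) = Real.exp (b * Z) := by
      simp
    rw [e1, e2]
    have hZ' : (Z : ℝ) ≤ k := by exact_mod_cast hZ
    have h3 : Real.exp (b * Z) ^ 2 ≤ Real.exp (2 * (b * k)) := by
      rw [← Real.exp_nat_mul]
      refine Real.exp_le_exp.2 ?_
      push_cast
      have := mul_le_mul_of_nonneg_left hZ' hb
      linarith
    have h4 : ((k : ℝ) - Z) * Real.exp (b * Z) ^ 2 ≤ k * Real.exp (2 * (b * k)) := by
      apply mul_le_mul _ h3 (by positivity) (by positivity)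
      linarith [(Nat.cast_nonneg Z : (0 : ℝ) ≤ Z)]
    nlinarith
  refine (percExp_mono hb key).trans ?_
  rw [percExp_add, percExp_sub, percExp_const_mul, percExp_const_mul, h1, h2, percExp_const]
  have : (I.card : ℝ) ≤ k := by exact_mod_cast hmk
  nlinarith

/-- Mean-square distance of the number of vertices reached from the giant's size, when a
positive fraction is reached. -/
theorem percExp_reach_giant_le {n q : ℕ} (b : ℝ) (hb : 0 ≤ b) (x : Conf n q) (j : Fin q)
    {I : Finset (Fin n)} (hI : I ⊆ spinClass x j) {w : ℝ} (hw : 0 < w)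
    (hl : 1 < b * (spinClass x j).card)
    (hg : 0 < 1 - w - Real.exp (-(b * (spinClass x j).card) * w)) :
    percExp b (monoPairs x) (fun E =>
      if w * (spinClass x j).card ≤ (reachSet E I).card then
        (((reachSet E I).card : ℝ)
          - theta (b * (spinClass x j).card) * (spinClass x j).card) ^ 2 else 0)
      ≤ ((I.card : ℝ) ^ 2
        + (spinClass x j).card * Real.exp (2 * (b * (spinClass x j).card)))
        / (1 - w - Real.exp (-(b * (spinClass x j).card) * w)) ^ 2 := by
  set k := (spinClass x j).card with hk
  set g := 1 - w - Real.exp (-(b * k) * w) with hgd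
  rw [le_div_iff₀ (by positivity), mul_comm, ← percExp_const_mul]
  refine le_trans (percExp_mono hb fun E hE => ?_) (percExp_reach_sq_le b hb x j hI)
  rw [← hk]
  split_ifs with hZ
  · set Z := (reachSet E I).card
    have hk0 : (0 : ℝ) < k := by
      rcases Nat.eq_zero_or_pos k with h | h
      · rw [h] at hl
        norm_num at hl
      · exact_mod_cast h
    have h1 := mul_abs_sub_theta_le (z := Z / k) hl hw hg (by rw [le_div_iff₀ hk0]; exact hZ)
    rw [← hgd] at h1
    have h2 : Real.exp (-(b * k) * (Z / k)) = Real.exp (-(b * Z)) := by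
      congr 1
      field_simp
    rw [h2] at h1
    rw [← mul_pow]
    rw [← sq_abs, ← sq_abs (_ - _ : ℝ)]
    refine pow_le_pow_left₀ (abs_nonneg _) ?_ 2
    rw [abs_mul, abs_of_pos hg]
    have h3 : |(Z : ℝ) - theta (b * k) * k| = k * |Z / k - theta (b * k)| := by
      rw [← abs_of_pos hk0, ← abs_mul, abs_of_pos hk0]
      congr 1
      field_simp
    have h4 : ((k : ℝ) - Z) * Real.exp (b * Z) - k
        = k * Real.exp (b * Z) * (1 - Z / k - Real.exp (-(b * Z))) := by
      have : Real.exp (b * Z) * Real.exp (-(b * Z)) = 1 := by rw [← Real.exp_add]; simp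
      have h5 : k * Real.exp (b * Z) * (1 - Z / k - Real.exp (-(b * Z)))
        = k * Real.exp (b * Z) - Real.exp (b * Z) * (k * (Z / k))
          - k * (Real.exp (b * Z) * Real.exp (-(b * Z))) := by ring
      rw [h5, this, mul_div_cancel₀ _ hk0.ne']
      ring
    rw [h3, h4, abs_mul, abs_of_pos (by positivity : 0 < k * Real.exp (b * Z))]
    have h6 : 1 ≤ Real.exp (b * Z) := Real.one_le_exp (by positivity)
    calc g * (k * |(Z : ℝ) / k - theta (b * k)|)
        = k * 1 * (g * |(Z : ℝ) / k - theta (b * k)|) := by ring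
      _ ≤ k * Real.exp (b * Z) * |1 - (Z : ℝ) / k - Real.exp (-(b * Z))| := by
        gcongr
  · rw [mul_zero]
    positivity

theorem choose_mul_pow_le {k s : ℕ} {r : ℝ} (hr : 0 ≤ r) :
    ∀ i : ℕ, (∀ l < i, r * ((k : ℝ) - l) ≤ (k : ℝ) - s - l) → i ≤ k →
      (k.choose i : ℝ) * r ^ i ≤ ((k - s).choose i : ℝ) := by
  intro i hi hik
  have hf : ∀ i : ℕ, (∀ l < i, r * ((k : ℝ) - l) ≤ (k : ℝ) - s - l) → i ≤ k →
      (k.descFactorial i : ℝ) * r ^ i ≤ ((k - s).descFactorial i : ℝ) := by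
    intro i
    induction i with
    | zero => simp
    | succ i ih =>
      intro h1 h2
      have h3 := ih (fun l hl => h1 l (hl.trans (Nat.lt_succ_self i))) (by omega)
      have h4 := h1 i (Nat.lt_succ_self i)
      rw [Nat.descFactorial_succ, Nat.descFactorial_succ]
      have h5 : (0 : ℝ) ≤ (k : ℝ) - i := by
        have : (i : ℝ) ≤ k := by exact_mod_cast (by omega : i ≤ k)
        linarith
      have h6 : s + i ≤ k := by
        have : (s : ℝ) + i ≤ k := by
          have := mul_nonneg hr h5
          linarith
        exact_mod_cast this
      have h7 : (((k - s - i : ℕ)) : ℝ) = (k : ℝ) - s - i := by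
        rw [Nat.cast_sub (by omega), Nat.cast_sub (by omega)]
      have h8 : (((k - i : ℕ)) : ℝ) = (k : ℝ) - i := by
        rw [Nat.cast_sub (by omega)]
      push_cast
      rw [h7, h8, pow_succ]
      calc ((k : ℝ) - i) * (k.descFactorial i) * (r ^ i * r)
          = (r * ((k : ℝ) - i)) * ((k.descFactorial i) * r ^ i) := by ring
        _ ≤ ((k : ℝ) - s - i) * ((k - s).descFactorial i) := by
          apply mul_le_mul h4 h3 (by positivity)
          exact (mul_nonneg hr h5).trans h4
  have h := hf i hi hik
  rw [Nat.descFactorial_eq_factorial_mul_choose, Nat.descFactorial_eq_factorial_mul_choose] at h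
  push_cast at h
  have hfac : (0 : ℝ) < i.factorial := by exact_mod_cast Nat.factorial_pos i
  rw [mul_assoc] at h
  exact le_of_mul_le_mul_left h hfac

/-- Exponential bound for the probability of reaching exactly `s` vertices. -/
theorem percExp_card_eq_le {n q : ℕ} (b : ℝ) (hb : 0 ≤ b) (x : Conf n q) (j : Fin q)
    {I : Finset (Fin n)} (hI : I ⊆ spinClass x j) {g : ℝ} (hg0 : 0 < g) (hg1 : g < 1 / 2)
    (hk : 1 ≤ g * (spinClass x j).card) {s : ℕ}
    (h : Real.exp (-(b * (spinClass x j).card - g) * (s / (spinClass x j).card))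
      ≤ 1 - (s / (spinClass x j).card) / (1 - g)) :
    percExp b (monoPairs x) (fun E => if (reachSet E I).card = s then 1 else 0)
      ≤ Real.exp (-(g ^ 2 / 2 * s)) := by
  set k := (spinClass x j).card with hkd
  have hk0 : (0 : ℝ) < k := by
    by_contra! h0
    nlinarith
  set i := ⌊g * k⌋₊ with hi
  have hi1 : (i : ℝ) ≤ g * k := Nat.floor_le (by positivity)
  have hi2 : g * k / 2 ≤ i := by
    have h1 : g * k < i + 1 := Nat.lt_floor_add_one _
    have h2 : 1 ≤ i := Nat.le_floor (by simpa using hk)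
    have h3 : (1 : ℝ) ≤ i := by exact_mod_cast h2
    linarith
  have hik : i ≤ k := by
    have : (i : ℝ) ≤ k := by nlinarith
    exact_mod_cast this
  set r := Real.exp (-(b * k - g) * (s / k)) with hr
  have hr0 : 0 < r := Real.exp_pos _
  have hch : (k.choose i : ℝ) * r ^ i ≤ ((k - s).choose i : ℝ) := by
    refine choose_mul_pow_le hr0.le i (fun l hl => ?_) hik
    have hl' : (l : ℝ) ≤ g * k := le_trans (by exact_mod_cast hl.le) hi1
    have h1g : 0 < 1 - g := by linarith
    have h2 : (1 - g) * k ≤ (k : ℝ) - l := by linarith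
    have h3 : (0 : ℝ) ≤ (k : ℝ) - l := le_trans (by positivity) h2
    calc r * ((k : ℝ) - l) ≤ (1 - (s / k) / (1 - g)) * ((k : ℝ) - l) :=
          mul_le_mul_of_nonneg_right h h3
      _ = ((k : ℝ) - l) - s * (((k : ℝ) - l) / ((1 - g) * k)) := by
          field_simp
      _ ≤ ((k : ℝ) - l) - s * 1 := by
          gcongr
          rw [le_div_iff₀ (by positivity)]
          linarith
      _ = (k : ℝ) - s - l := by ring
  have h1 := percExp_choose b x j hI i
  rw [← hkd] at h1
  have h2 : ((k - s).choose i : ℝ) * Real.exp (b * (i * s)) *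
      percExp b (monoPairs x) (fun E => if (reachSet E I).card = s then 1 else 0)
      ≤ (k.choose i : ℝ) := by
    rw [← percExp_const_mul]
    refine le_trans (percExp_mono hb fun E hE => ?_) (h1.le.trans ?_)
    · split_ifs with hs
      · rw [hs, mul_one]
      · rw [mul_zero]
        positivity
    · exact_mod_cast Nat.choose_le_choose i (Nat.sub_le _ _)
  set p := percExp b (monoPairs x) (fun E => if (reachSet E I).card = s then 1 else 0)
  have hp : 0 ≤ p := percExp_nonneg hb fun E _ => by split_ifs <;> norm_num
  have hck : (0 : ℝ) < k.choose i := by exact_mod_cast Nat.choose_pos hik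
  have h3 : (k.choose i : ℝ) * (r ^ i * Real.exp (b * (i * s)) * p) ≤ k.choose i * 1 := by
    calc (k.choose i : ℝ) * (r ^ i * Real.exp (b * (i * s)) * p)
        = (k.choose i : ℝ) * r ^ i * Real.exp (b * (i * s)) * p := by ring
      _ ≤ ((k - s).choose i : ℝ) * Real.exp (b * (i * s)) * p := by gcongr
      _ ≤ _ := by rw [mul_one]; exact h2
  have h4 := le_of_mul_le_mul_left h3 hck
  have h5 : r ^ i * Real.exp (b * (i * s)) = Real.exp (g * s * (i / k)) := by
    rw [hr, ← Real.exp_nat_mul, ← Real.exp_add]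
    congr 1
    field_simp
    ring
  rw [h5] at h4
  have h6 : Real.exp (g ^ 2 / 2 * s) ≤ Real.exp (g * s * (i / k)) := by
    refine Real.exp_le_exp.2 ?_
    have h7 : g / 2 ≤ i / k := by
      rw [le_div_iff₀ hk0]
      linarith
    calc g ^ 2 / 2 * s = g * s * (g / 2) := by ring
      _ ≤ g * s * (i / k) := by gcongr
  rw [Real.exp_neg, ← one_div, le_div_iff₀ (Real.exp_pos _), mul_comm]
  exact (mul_le_mul_of_nonneg_right h6 hp).trans h4

/-- The expected component size in a subcritical class. -/
theorem percExp_subcritical {n q : ℕ} (b : ℝ) (hb : 0 ≤ b) (x : Conf n q) (j : Fin q)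
    {v : Fin n} (hv : v ∈ spinClass x j) (hl : b * (spinClass x j).card < 1) :
    percExp b (monoPairs x) (fun E => ((reachSet E {v}).card : ℝ))
      ≤ 2 / (1 - b * (spinClass x j).card) := by
  have hI : {v} ⊆ spinClass x j := Finset.singleton_subset_iff.2 hv
  have h1 := percExp_choose b x j hI 1
  have hk1 : 1 ≤ (spinClass x j).card := Finset.card_pos.2 ⟨v, hv⟩
  set k := (spinClass x j).card with hkd
  have hk0 : (0 : ℝ) < k := by exact_mod_cast hk1
  rw [Finset.card_singleton, Nat.choose_one_right, Nat.cast_sub hk1, Nat.cast_one] at h1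
  have hd : 0 < 1 - b * k := by linarith
  have h2 : percExp b (monoPairs x) (fun E =>
      (((k - (reachSet E {v}).card).choose 1 : ℝ)
        * Real.exp (b * (1 * (reachSet E {v}).card))))
      ≤ percExp b (monoPairs x) (fun E =>
        k - (1 - b * k) / 2 * ((reachSet E {v}).card : ℝ)) := by
    refine percExp_mono hb fun E hE => ?_
    have hZ := card_reachSet_le hE hI
    rw [← hkd] at hZ
    set Z := (reachSet E {v}).card
    have hZ' : (Z : ℝ) ≤ k := by exact_mod_cast hZ
    rw [Nat.choose_one_right, Nat.cast_sub hZ, one_mul]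
    obtain ⟨z, hz⟩ : ∃ z, z = (Z : ℝ) / k := ⟨_, rfl⟩
    have hz0 : 0 ≤ z := by rw [hz]; positivity
    have hz1 : z ≤ 1 := by rw [hz]; exact (div_le_one hk0).2 hZ'
    have hZz : (Z : ℝ) = k * z := by rw [hz]; field_simp
    have h3 : 1 - z ≤ Real.exp (-z) := by linarith [Real.add_one_le_exp (-z)]
    have h4 : (1 - z) * Real.exp (b * Z) ≤ Real.exp (-((1 - b * k) * z)) := by
      calc (1 - z) * Real.exp (b * Z) ≤ Real.exp (-z) * Real.exp (b * Z) := by gcongr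
        _ = Real.exp (-((1 - b * k) * z)) := by
          rw [← Real.exp_add, hZz]
          congr 1
          ring
    have hy0 : 0 ≤ (1 - b * k) * z := by positivity
    have hy1 : (1 - b * k) * z ≤ 1 := by
      have := mul_nonneg hb hk0.le
      nlinarith
    have h5 : Real.exp (-((1 - b * k) * z)) ≤ 1 - (1 - b * k) * z / 2 := by
      refine (exp_neg_le_inv hy0).trans ?_
      rw [div_le_iff₀ (by linarith)]
      nlinarith
    calc ((k : ℝ) - Z) * Real.exp (b * Z) = k * ((1 - z) * Real.exp (b * Z)) := by
          rw [hZz]; ring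
      _ ≤ k * (1 - (1 - b * k) * z / 2) := by
          exact mul_le_mul_of_nonneg_left (h4.trans h5) hk0.le
      _ = k - (1 - b * k) / 2 * Z := by rw [hZz]; ring
  rw [h1, percExp_sub, percExp_const, percExp_const_mul] at h2
  rw [le_div_iff₀ hd]
  linarith

/-! ### The giant component of a supercritical class -/

/-- Quantitative supercriticality of the class of spin `j`. -/
structure IsSupercritical {n q : ℕ} (b : ℝ) (x : Conf n q) (j : Fin q) (L w g d : ℝ) : Prop where
  nonneg : 0 ≤ b
  one_lt : 1 < b * (spinClass x j).card
  le_bound : b * (spinClass x j).card ≤ L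
  size_le : (n : ℝ) ≤ L * (spinClass x j).card
  w_pos : 0 < w
  w_le : 2 * w ≤ 1
  g_pos : 0 < g
  g_lt : g < 1 / 2
  one_le : 1 ≤ g * (spinClass x j).card
  d_pos : 0 < d
  defect : d ≤ 1 - w - Real.exp (-(b * (spinClass x j).card) * w)
  tail : ∀ s : ℕ, (s : ℝ) ≤ 2 * w * (spinClass x j).card →
    Real.exp (-(b * (spinClass x j).card - g) * (s / (spinClass x j).card))
      ≤ 1 - (s / (spinClass x j).card) / (1 - g)

/-- The squared deviation from the giant's size, on the event that many vertices are reached. -/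
noncomputable def giantDev {n q : ℕ} (b : ℝ) (x : Conf n q) (j : Fin q) (w : ℝ)
    (I : Finset (Fin n)) (E : Finset (Fin n × Fin n)) : ℝ :=
  if w * (spinClass x j).card ≤ (reachSet E I).card then
    (((reachSet E I).card : ℝ)
      - theta (b * (spinClass x j).card) * (spinClass x j).card) ^ 2 else 0

theorem giantDev_nonneg {n q : ℕ} (b : ℝ) (x : Conf n q) (j : Fin q) (w : ℝ)
    (I : Finset (Fin n)) (E : Finset (Fin n × Fin n)) : 0 ≤ giantDev b x j w I E := by
  unfold giantDev
  split_ifs <;> positivity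

theorem mem_reachSet_singleton {n : ℕ} {E : Finset (Fin n × Fin n)} {u v : Fin n} :
    u ∈ reachSet E {v} ↔ (graphOf E).Reachable v u := by
  simp [mem_reachSet]

theorem reachSet_union {n : ℕ} (E : Finset (Fin n × Fin n)) (I J : Finset (Fin n)) :
    reachSet E (I ∪ J) = reachSet E I ∪ reachSet E J := by
  ext u
  simp only [mem_reachSet, Finset.mem_union]
  constructor
  · rintro ⟨v, hv | hv, h⟩
    · exact Or.inl ⟨v, hv, h⟩
    · exact Or.inr ⟨v, hv, h⟩
  · rintro (⟨v, hv, h⟩ | ⟨v, hv, h⟩)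
    · exact ⟨v, Or.inl hv, h⟩
    · exact ⟨v, Or.inr hv, h⟩

theorem reachSet_eq_of_reachable {n : ℕ} {E : Finset (Fin n × Fin n)} {u v : Fin n}
    (h : (graphOf E).Reachable u v) : reachSet E {u} = reachSet E {v} := by
  ext w
  rw [mem_reachSet_singleton, mem_reachSet_singleton]
  exact ⟨fun h' => h.symm.trans h', fun h' => h.trans h'⟩

theorem reachSet_disjoint {n : ℕ} {E : Finset (Fin n × Fin n)} {u v : Fin n}
    (h : ¬ (graphOf E).Reachable u v) : Disjoint (reachSet E {u}) (reachSet E {v}) := by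
  rw [Finset.disjoint_left]
  intro w hw hw'
  rw [mem_reachSet_singleton] at hw hw'
  exact h (hw.trans hw'.symm)

section Supercritical

variable {n q : ℕ} {b : ℝ} {x : Conf n q} {j : Fin q} {L w g d : ℝ}

theorem IsSupercritical.card_pos (h : IsSupercritical b x j L w g d) :
    (0 : ℝ) < (spinClass x j).card := by
  have := h.one_le
  have := h.g_pos
  by_contra! h0
  nlinarith

theorem IsSupercritical.one_le_card (h : IsSupercritical b x j L w g d) :
    (1 : ℝ) ≤ (spinClass x j).card := by
  exact_mod_cast Nat.one_le_iff_ne_zero.2 fun h0 => by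
    have := h.card_pos
    rw [h0] at this
    simp at this

theorem IsSupercritical.giantDev_le (h : IsSupercritical b x j L w g d) {I : Finset (Fin n)}
    (hI : I ⊆ spinClass x j) (hI2 : I.card ≤ 2) :
    percExp b (monoPairs x) (giantDev b x j w I)
      ≤ (4 + Real.exp (2 * L)) / d ^ 2 * (spinClass x j).card := by
  have h1 := percExp_reach_giant_le b h.nonneg x j hI h.w_pos h.one_lt
    (h.d_pos.trans_le h.defect)
  refine h1.trans ?_
  have hd := h.d_pos
  have hk := h.one_le_card
  set k : ℝ := ((spinClass x j).card : ℝ)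
  have h2 : (I.card : ℝ) ^ 2 ≤ 4 * k := by
    have : (I.card : ℝ) ≤ 2 := by exact_mod_cast hI2
    have : (0 : ℝ) ≤ I.card := Nat.cast_nonneg _
    nlinarith
  have h3 : Real.exp (2 * (b * k)) ≤ Real.exp (2 * L) :=
    Real.exp_le_exp.2 (by linarith [h.le_bound])
  rw [div_mul_eq_mul_div]
  refine div_le_div₀ (by positivity) ?_ (by positivity)
    (pow_le_pow_left₀ hd.le h.defect 2)
  nlinarith

/-- Two distinct large components are unlikely. -/
theorem IsSupercritical.two_large_le (h : IsSupercritical b x j L w g d) {u v : Fin n}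
    (hu : u ∈ spinClass x j) (hv : v ∈ spinClass x j) :
    percExp b (monoPairs x) (fun E => if w * (spinClass x j).card ≤ (reachSet E {u}).card ∧
        w * (spinClass x j).card ≤ (reachSet E {v}).card ∧ ¬ (graphOf E).Reachable u v
        then 1 else 0)
      ≤ 9 * ((4 + Real.exp (2 * L)) / d ^ 2) / (w ^ 2 * (spinClass x j).card) := by
  set M := (4 + Real.exp (2 * L)) / d ^ 2
  have hk := h.card_pos
  have hw := h.w_pos
  have hu' := Finset.singleton_subset_iff.2 hu
  have hv' := Finset.singleton_subset_iff.2 hv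
  have h1 := h.giantDev_le hu' (by simp)
  have h2 := h.giantDev_le hv' (by simp)
  have h3 := h.giantDev_le (I := {u} ∪ {v}) (Finset.union_subset hu' hv')
    ((Finset.card_union_le _ _).trans (by simp))
  have hth := lt_theta h.one_lt hw (h.d_pos.trans_le h.defect)
  have key : ∀ E ⊆ monoPairs x, (w * (spinClass x j).card) ^ 2 *
      (if w * (spinClass x j).card ≤ (reachSet E {u}).card ∧
        w * (spinClass x j).card ≤ (reachSet E {v}).card ∧ ¬ (graphOf E).Reachable u v
        then 1 else 0) ≤ 3 * (giantDev b x j w {u} E + giantDev b x j w {v} E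
          + giantDev b x j w ({u} ∪ {v}) E) := by
    intro E hE
    split_ifs with hc
    · obtain ⟨c1, c2, c3⟩ := hc
      have hcard : ((reachSet E ({u} ∪ {v})).card : ℝ)
          = (reachSet E {u}).card + (reachSet E {v}).card := by
        rw [reachSet_union, Finset.card_union_of_disjoint (reachSet_disjoint c3)]
        push_cast
        rfl
      unfold giantDev
      rw [if_pos c1, if_pos c2, if_pos (by
        rw [hcard]
        linarith [(Nat.cast_nonneg (reachSet E {v}).card : (0 : ℝ) ≤ _)]), hcard]
      set θ := theta (b * (spinClass x j).card)
      set k : ℝ := ((spinClass x j).card : ℝ)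
      set a : ℝ := ((reachSet E {u}).card : ℝ)
      set c : ℝ := ((reachSet E {v}).card : ℝ)
      have h4 : (w * k) ^ 2 ≤ (θ * k) ^ 2 :=
        pow_le_pow_left₀ (by positivity) (by gcongr) 2
      have h5 : (θ * k) ^ 2 ≤ 3 * ((a - θ * k) ^ 2 + (c - θ * k) ^ 2
          + (a + c - θ * k) ^ 2) := by
        nlinarith [sq_nonneg ((a - θ * k) - (c - θ * k)), sq_nonneg ((a - θ * k)
          + (a + c - θ * k)), sq_nonneg ((c - θ * k) + (a + c - θ * k))]
      linarith
    · rw [mul_zero]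
      have := giantDev_nonneg b x j w {u} E
      have := giantDev_nonneg b x j w {v} E
      have := giantDev_nonneg b x j w ({u} ∪ {v}) E
      linarith
  have h4 := percExp_mono h.nonneg key
  rw [percExp_const_mul, percExp_const_mul, percExp_add, percExp_add] at h4
  rw [le_div_iff₀ (by positivity)]
  set p := percExp b (monoPairs x) (fun E => if w * (spinClass x j).card ≤ (reachSet E {u}).card ∧
        w * (spinClass x j).card ≤ (reachSet E {v}).card ∧ ¬ (graphOf E).Reachable u v
        then 1 else 0)
  set k : ℝ := ((spinClass x j).card : ℝ)
  have h5 : k * (p * (w ^ 2 * k)) ≤ k * (9 * M) := by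
    calc k * (p * (w ^ 2 * k)) = (w * k) ^ 2 * p := by ring
      _ ≤ k * (9 * M) := by linarith
  exact le_of_mul_le_mul_left h5 hk

theorem summable_mul_exp_neg {c : ℝ} (hc : 0 < c) :
    Summable (fun s : ℕ => (s : ℝ) * Real.exp (-(c * s))) := by
  have h1 : ‖Real.exp (-c)‖ < 1 := by
    rw [Real.norm_of_nonneg (Real.exp_pos _).le]
    rw [← Real.exp_zero]
    exact Real.exp_lt_exp.2 (by linarith)
  have h2 := summable_pow_mul_geometric_of_norm_lt_one 1 h1
  refine h2.congr fun s => ?_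
  rw [pow_one, ← Real.exp_nat_mul]
  congr 2
  ring

/-- Small components have bounded expected size. -/
theorem IsSupercritical.small_le (h : IsSupercritical b x j L w g d) {v : Fin n}
    (hv : v ∈ spinClass x j) :
    percExp b (monoPairs x) (fun E =>
      if w * (spinClass x j).card ≤ (reachSet E {v}).card then 0
        else ((reachSet E {v}).card : ℝ))
      ≤ ∑' s : ℕ, (s : ℝ) * Real.exp (-(g ^ 2 / 2 * s)) := by
  have hg := h.g_pos
  have hw := h.w_pos
  have hv' := Finset.singleton_subset_iff.2 hv
  set k := (spinClass x j).card with hk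
  set R := (Finset.range (k + 1)).filter (fun s : ℕ => (s : ℝ) < w * k)
  have key : ∀ E ⊆ monoPairs x, (if w * k ≤ (reachSet E {v}).card then 0
        else ((reachSet E {v}).card : ℝ))
      ≤ ∑ s ∈ R, (s : ℝ) * (if (reachSet E {v}).card = s then 1 else 0) := by
    intro E hE
    split_ifs with hc
    · exact Finset.sum_nonneg fun s _ => by positivity
    · have hmem : (reachSet E {v}).card ∈ R := by
        rw [Finset.mem_filter, Finset.mem_range]
        exact ⟨Nat.lt_succ_of_le (card_reachSet_le hE hv'), not_le.1 hc⟩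
      refine le_trans ?_ (Finset.single_le_sum (f := fun s : ℕ =>
        (s : ℝ) * (if (reachSet E {v}).card = s then 1 else 0))
        (fun s _ => by positivity) hmem)
      simp
  refine (percExp_mono h.nonneg key).trans ?_
  rw [percExp_sum]
  refine le_trans (Finset.sum_le_sum fun s hs => ?_)
    ((summable_mul_exp_neg (by positivity)).sum_le_tsum R fun s _ => by positivity)
  rw [percExp_const_mul]
  refine mul_le_mul_of_nonneg_left ?_ (Nat.cast_nonneg s)
  refine percExp_card_eq_le b h.nonneg x j hv' h.g_pos h.g_lt h.one_le (h.tail s ?_)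
  have h1 := (Finset.mem_filter.1 hs).2
  have : (0 : ℝ) ≤ w * k := by positivity
  rw [← hk]
  linarith

/-- The seeds with index below `i`. -/
def initialSeeds {n q : ℕ} (x : Conf n q) (j : Fin q) (i : ℕ) : Finset (Fin n) :=
  (spinClass x j).filter (fun v => (v : ℕ) < i)

theorem card_reachSet_initialSeeds_succ (E : Finset (Fin n × Fin n)) (i : ℕ) {K : ℝ}
    (hK0 : 0 ≤ K) (hK : ∀ v ∈ spinClass x j, ((reachSet E {v}).card : ℝ) ≤ K) :
    ((reachSet E (initialSeeds x j (i + 1))).card : ℝ)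
      ≤ (reachSet E (initialSeeds x j i)).card + K := by
  by_cases hex : ∃ v ∈ spinClass x j, (v : ℕ) = i
  · obtain ⟨v, hv, rfl⟩ := hex
    have h1 : initialSeeds x j ((v : ℕ) + 1) = initialSeeds x j v ∪ {v} := by
      ext u
      simp only [initialSeeds, Finset.mem_filter, Finset.mem_union, Finset.mem_singleton]
      constructor
      · rintro ⟨h1, h2⟩
        rcases Nat.lt_succ_iff_lt_or_eq.1 h2 with h3 | h3
        · exact Or.inl ⟨h1, h3⟩
        · exact Or.inr (Fin.ext h3)
      · rintro (⟨h1, h2⟩ | rfl)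
        · exact ⟨h1, by omega⟩
        · exact ⟨hv, by omega⟩
    rw [h1, reachSet_union]
    have h2 : ((reachSet E (initialSeeds x j v) ∪ reachSet E {v}).card : ℝ)
        ≤ (reachSet E (initialSeeds x j v)).card + (reachSet E {v}).card := by
      exact_mod_cast Finset.card_union_le _ _
    linarith [hK v hv]
  · have h1 : initialSeeds x j (i + 1) = initialSeeds x j i := by
      ext u
      simp only [initialSeeds, Finset.mem_filter]
      push Not at hex
      constructor
      · rintro ⟨h1, h2⟩
        have := hex u h1
        exact ⟨h1, by omega⟩
      · rintro ⟨h1, h2⟩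
        exact ⟨h1, by omega⟩
    rw [h1]
    linarith

/-- If every component is small, some initial set of seeds reaches an intermediate number of
vertices. -/
theorem IsSupercritical.exists_intermediate (h : IsSupercritical b x j L w g d)
    {E : Finset (Fin n × Fin n)}
    (hs : ∀ v ∈ spinClass x j, ((reachSet E {v}).card : ℝ) < w * (spinClass x j).card) :
    ∃ i ≤ n, w * (spinClass x j).card ≤ (reachSet E (initialSeeds x j i)).card ∧
      ((reachSet E (initialSeeds x j i)).card : ℝ) ≤ 2 * w * (spinClass x j).card := by
  have hk := h.card_pos
  have hw := h.w_pos
  have hn : w * (spinClass x j).card ≤ (reachSet E (initialSeeds x j n)).card := by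
    have h1 : initialSeeds x j n = spinClass x j := by
      ext u
      simp [initialSeeds]
    have h2 : ((spinClass x j).card : ℝ) ≤ (reachSet E (initialSeeds x j n)).card := by
      rw [h1]
      exact_mod_cast Finset.card_le_card (subset_reachSet E _)
    have := h.w_le
    nlinarith
  have hex : ∃ i, w * (spinClass x j).card ≤ (reachSet E (initialSeeds x j i)).card := ⟨n, hn⟩
  refine ⟨Nat.find hex, Nat.find_min' hex hn, Nat.find_spec hex, ?_⟩
  have hne : Nat.find hex ≠ 0 := by
    intro h0
    have h1 := Nat.find_spec hex
    rw [h0] at h1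
    have h2 : reachSet E (initialSeeds x j 0) = ∅ := by
      ext u
      simp [mem_reachSet, initialSeeds]
    rw [h2] at h1
    have : 0 < w * (spinClass x j).card := by positivity
    simp at h1
    linarith
  obtain ⟨i, hi⟩ := Nat.exists_eq_succ_of_ne_zero hne
  have h1 := Nat.find_min hex (m := i) (by omega)
  have h2 := card_reachSet_initialSeeds_succ (x := x) (j := j) E i
    (K := w * (spinClass x j).card) (by positivity) (fun v hv => (hs v hv).le)
  rw [hi, Nat.succ_eq_add_one]
  push Not at h1
  linarith

/-- A large component exists with high probability. -/
theorem IsSupercritical.no_large_le (h : IsSupercritical b x j L w g d) :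
    percExp b (monoPairs x) (fun E =>
      if ∀ v ∈ spinClass x j, ((reachSet E {v}).card : ℝ) < w * (spinClass x j).card
        then 1 else 0)
      ≤ 12 * (L + 1) / (g ^ 2 / 2 * w) ^ 3 / (spinClass x j).card := by
  have hk0 := h.card_pos
  have hk1 := h.one_le_card
  have hw := h.w_pos
  have hg := h.g_pos
  set k := (spinClass x j).card with hk
  set R := (Finset.range (k + 1)).filter (fun s : ℕ => w * k ≤ s ∧ (s : ℝ) ≤ 2 * w * k)
  have key : ∀ E ⊆ monoPairs x,
      (if ∀ v ∈ spinClass x j, ((reachSet E {v}).card : ℝ) < w * k then (1 : ℝ) else 0)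
      ≤ ∑ i ∈ Finset.range (n + 1), ∑ s ∈ R,
        (if (reachSet E (initialSeeds x j i)).card = s then 1 else 0) := by
    intro E hE
    split_ifs with hc
    · obtain ⟨i, hin, h1, h2⟩ := h.exists_intermediate hc
      have hmem : (reachSet E (initialSeeds x j i)).card ∈ R := by
        rw [Finset.mem_filter, Finset.mem_range]
        exact ⟨Nat.lt_succ_of_le (card_reachSet_le hE (Finset.filter_subset _ _)), h1, h2⟩
      refine le_trans ?_ (Finset.single_le_sum (f := fun i => ∑ s ∈ R,
        (if (reachSet E (initialSeeds x j i)).card = s then (1 : ℝ) else 0))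
        (fun i _ => Finset.sum_nonneg fun s _ => by positivity)
        (Finset.mem_range.2 (Nat.lt_succ_of_le hin)))
      refine le_trans ?_ (Finset.single_le_sum (f := fun s : ℕ =>
        if (reachSet E (initialSeeds x j i)).card = s then (1 : ℝ) else 0)
        (fun s _ => by positivity) hmem)
      simp
    · exact Finset.sum_nonneg fun i _ => Finset.sum_nonneg fun s _ => by positivity
  set c := g ^ 2 / 2 * w with hc
  have hc0 : 0 < c := by positivity
  have hprob : ∀ i, ∀ s ∈ R, percExp b (monoPairs x) (fun E =>
      if (reachSet E (initialSeeds x j i)).card = s then 1 else 0) ≤ Real.exp (-(c * k)) := by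
    intro i s hs
    have hs' := (Finset.mem_filter.1 hs).2
    refine (percExp_card_eq_le b h.nonneg x j (Finset.filter_subset _ _) h.g_pos h.g_lt
      h.one_le (h.tail s hs'.2)).trans ?_
    refine Real.exp_le_exp.2 (neg_le_neg ?_)
    rw [hc, mul_assoc]
    exact mul_le_mul_of_nonneg_left hs'.1 (by positivity)
  have h1 : percExp b (monoPairs x) (fun E =>
      if ∀ v ∈ spinClass x j, ((reachSet E {v}).card : ℝ) < w * k then (1 : ℝ) else 0)
      ≤ ((n : ℝ) + 1) * (((k : ℝ) + 1) * Real.exp (-(c * k))) := by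
    refine (percExp_mono h.nonneg key).trans ?_
    rw [percExp_sum]
    simp_rw [percExp_sum]
    have hR : (R.card : ℝ) ≤ (k : ℝ) + 1 := by
      have := Finset.card_filter_le (Finset.range (k + 1))
        (fun s : ℕ => w * k ≤ s ∧ (s : ℝ) ≤ 2 * w * k)
      rw [Finset.card_range] at this
      exact_mod_cast this
    calc _ ≤ ∑ i ∈ Finset.range (n + 1), ∑ s ∈ R, Real.exp (-(c * k)) :=
          Finset.sum_le_sum fun i _ => Finset.sum_le_sum fun s hs => hprob i s hs
      _ = ((n : ℝ) + 1) * (R.card * Real.exp (-(c * k))) := by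
          simp
      _ ≤ _ := by gcongr
  have h2 : Real.exp (-(c * k)) ≤ 6 / (c * k) ^ 3 := by
    have h3 := Real.pow_div_factorial_le_exp (c * k) (by positivity) 3
    rw [Real.exp_neg, ← one_div, div_le_div_iff₀ (Real.exp_pos _) (by positivity)]
    have h4 : ((Nat.factorial 3 : ℕ) : ℝ) = 6 := by norm_num [Nat.factorial]
    rw [h4, div_le_iff₀ (by norm_num)] at h3
    linarith
  have hL : 0 ≤ L := by linarith [h.one_lt, h.le_bound]
  have hn := h.size_le
  rw [← hk] at hn
  calc _ ≤ _ := h1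
    _ ≤ ((L + 1) * k) * ((2 * k) * (6 / (c * k) ^ 3)) := by
        gcongr
        · linarith
        · linarith
    _ = 12 * (L + 1) / c ^ 3 / k := by
        field_simp
        ring

end Supercritical

/-! ### Deviation of the giant and total size of the other components -/

theorem IsSupercritical.largest_dev_le {n q : ℕ} {b : ℝ} {x : Conf n q} {j : Fin q}
    {L w g d : ℝ} (h : IsSupercritical b x j L w g d)
    {r : Finset (Fin n × Fin n) → Fin n} (hr : ∀ E, r E ∈ spinClass x j)
    (hmax : ∀ E, ∀ v ∈ spinClass x j, (reachSet E {v}).card ≤ (reachSet E {r E}).card) :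
    percExp b (monoPairs x) (fun E => (((reachSet E {r E}).card : ℝ)
        - theta (b * (spinClass x j).card) * (spinClass x j).card) ^ 2)
      ≤ ((4 + Real.exp (2 * L)) / d ^ 2 / w + 12 * (L + 1) / (g ^ 2 / 2 * w) ^ 3)
        * (spinClass x j).card := by
  have hk0 := h.card_pos
  have hw := h.w_pos
  set M := (4 + Real.exp (2 * L)) / d ^ 2
  set M' := 12 * (L + 1) / (g ^ 2 / 2 * w) ^ 3
  have h1 := h.no_large_le
  have h2 : ∀ v ∈ spinClass x j, percExp b (monoPairs x) (giantDev b x j w {v})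
      ≤ M * (spinClass x j).card := fun v hv =>
    h.giantDev_le (Finset.singleton_subset_iff.2 hv) (by simp)
  have h3 := Finset.sum_le_sum h2
  rw [← percExp_sum, Finset.sum_const, nsmul_eq_mul] at h3
  set k : ℝ := ((spinClass x j).card : ℝ) with hk
  have key : ∀ E ⊆ monoPairs x, (((reachSet E {r E}).card : ℝ) - theta (b * k) * k) ^ 2
      ≤ (1 / (w * k)) * (∑ v ∈ spinClass x j, giantDev b x j w {v} E)
        + k ^ 2 * (if ∀ v ∈ spinClass x j, ((reachSet E {v}).card : ℝ) < w * k
          then 1 else 0) := by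
    intro E hE
    have hsub : reachSet E {r E} ⊆ spinClass x j :=
      reachSet_subset_spinClass hE (Finset.singleton_subset_iff.2 (hr E))
    rcases le_or_gt (w * k) ((reachSet E {r E}).card : ℝ) with hc | hc
    · have h4 : ((reachSet E {r E}).card : ℝ)
          * (((reachSet E {r E}).card : ℝ) - theta (b * k) * k) ^ 2
          ≤ ∑ v ∈ spinClass x j, giantDev b x j w {v} E := by
        refine le_trans ?_ (Finset.sum_le_sum_of_subset_of_nonneg hsub
          fun v _ _ => giantDev_nonneg b x j w {v} E)
        rw [← nsmul_eq_mul, ← Finset.sum_const]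
        refine Finset.sum_le_sum fun v hv => ?_
        have h5 := reachSet_eq_of_reachable (mem_reachSet_singleton.1 hv)
        unfold giantDev
        rw [← h5, if_pos hc]
      have h6 : w * k * (((reachSet E {r E}).card : ℝ) - theta (b * k) * k) ^ 2
          ≤ ∑ v ∈ spinClass x j, giantDev b x j w {v} E :=
        le_trans (mul_le_mul_of_nonneg_right hc (sq_nonneg _)) h4
      refine le_trans ?_ (le_add_of_nonneg_right (by positivity))
      rw [one_div, ← div_eq_inv_mul, le_div_iff₀ (by positivity)]
      linarith
    · rw [if_pos (fun v hv => lt_of_le_of_lt (by exact_mod_cast hmax E v hv) hc)]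
      refine le_trans ?_ (le_add_of_nonneg_left (mul_nonneg (by positivity)
        (Finset.sum_nonneg fun v _ => giantDev_nonneg b x j w {v} E)))
      rw [mul_one]
      have h7 : ((reachSet E {r E}).card : ℝ) ≤ k := by
        exact Nat.cast_le.2 (Finset.card_le_card hsub)
      obtain ⟨h8, h9⟩ := theta_nonneg_le_one (b * k)
      have h10 : 0 ≤ theta (b * k) * k := by positivity
      have h11 : theta (b * k) * k ≤ k := by nlinarith
      have h12 : (0 : ℝ) ≤ (reachSet E {r E}).card := Nat.cast_nonneg _
      apply sq_le_sq'
      · linarith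
      · linarith
  have h4 := percExp_mono h.nonneg key
  rw [percExp_add, percExp_const_mul, percExp_const_mul] at h4
  refine h4.trans ?_
  have h5 : 1 / (w * k) * percExp b (monoPairs x)
      (fun E => ∑ v ∈ spinClass x j, giantDev b x j w {v} E) ≤ 1 / (w * k) * (k * (M * k)) :=
    mul_le_mul_of_nonneg_left h3 (by positivity)
  have h6 := mul_le_mul_of_nonneg_left h1 (by positivity : 0 ≤ k ^ 2)
  have h7 : 1 / (w * k) * (k * (M * k)) = M / w * k := by field_simp
  have h8 : k ^ 2 * (M' / k) = M' * k := by field_simp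
  rw [h7] at h5
  rw [h8] at h6
  rw [add_mul]
  exact add_le_add h5 h6

theorem IsSupercritical.rest_le {n q : ℕ} {b : ℝ} {x : Conf n q} {j : Fin q}
    {L w g d : ℝ} (h : IsSupercritical b x j L w g d)
    {r : Finset (Fin n × Fin n) → Fin n}
    (hmax : ∀ E, ∀ v ∈ spinClass x j, (reachSet E {v}).card ≤ (reachSet E {r E}).card)
    (hr : ∀ E, r E ∈ spinClass x j) :
    percExp b (monoPairs x) (fun E => ∑ v ∈ spinClass x j \ reachSet E {r E},
        ((reachSet E {v}).card : ℝ))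
      ≤ ((∑' s : ℕ, (s : ℝ) * Real.exp (-(g ^ 2 / 2 * s)))
          + 9 * ((4 + Real.exp (2 * L)) / d ^ 2) / w ^ 3) * (spinClass x j).card := by
  have hk0 := h.card_pos
  have hw := h.w_pos
  set M := (4 + Real.exp (2 * L)) / d ^ 2
  set T := ∑' s : ℕ, (s : ℝ) * Real.exp (-(g ^ 2 / 2 * s))
  set S := spinClass x j with hS
  have h1 := Finset.sum_le_sum fun v (hv : v ∈ S) => h.small_le hv
  have h2 := Finset.sum_le_sum fun v (hv : v ∈ S) => Finset.sum_le_sum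
    fun u (hu : u ∈ S) => h.two_large_le hu hv
  rw [← percExp_sum] at h1
  simp_rw [← percExp_sum] at h2
  simp only [Finset.sum_const, nsmul_eq_mul] at h1 h2
  rw [← hS] at h1 h2
  set k : ℝ := (S.card : ℝ) with hk
  have key : ∀ E ⊆ monoPairs x, (∑ v ∈ S \ reachSet E {r E}, ((reachSet E {v}).card : ℝ))
      ≤ (∑ v ∈ S, if w * k ≤ (reachSet E {v}).card then 0 else ((reachSet E {v}).card : ℝ))
        + (1 / w) * ∑ v ∈ S, ∑ u ∈ S, (if w * k ≤ (reachSet E {u}).card ∧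
          w * k ≤ (reachSet E {v}).card ∧ ¬ (graphOf E).Reachable u v then 1 else 0) := by
    intro E hE
    have hsub : reachSet E {r E} ⊆ S :=
      reachSet_subset_spinClass hE (Finset.singleton_subset_iff.2 (hr E))
    rw [Finset.mul_sum, ← Finset.sum_add_distrib]
    refine le_trans (Finset.sum_le_sum fun v hv => ?_)
      (Finset.sum_le_sum_of_subset_of_nonneg Finset.sdiff_subset fun v _ _ =>
        add_nonneg (by positivity) (mul_nonneg (by positivity)
          (Finset.sum_nonneg fun u _ => by positivity)))
    rw [Finset.mem_sdiff] at hv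
    split_ifs with hc
    · rw [zero_add]
      have hb : w * k ≤ (reachSet E {r E}).card :=
        hc.trans (by exact_mod_cast hmax E v hv.1)
      have h3 : w * k ≤ ∑ u ∈ S, (if w * k ≤ (reachSet E {u}).card ∧
          w * k ≤ (reachSet E {v}).card ∧ ¬ (graphOf E).Reachable u v then (1 : ℝ) else 0) := by
        refine hb.trans (le_trans ?_ (Finset.sum_le_sum_of_subset_of_nonneg hsub
          fun u _ _ => by positivity))
        rw [← mul_one ((reachSet E {r E}).card : ℝ), ← nsmul_eq_mul, ← Finset.sum_const]
        refine Finset.sum_le_sum fun u hu => ?_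
        have h5 := mem_reachSet_singleton.1 hu
        rw [if_pos]
        refine ⟨?_, hc, fun hh => hv.2 (mem_reachSet_singleton.2 (h5.trans hh))⟩
        rw [← reachSet_eq_of_reachable h5]
        exact hb
      have h4 : ((reachSet E {v}).card : ℝ) ≤ k := by
        exact Nat.cast_le.2 (card_reachSet_le hE (Finset.singleton_subset_iff.2 hv.1))
      refine h4.trans ?_
      rw [one_div, ← div_eq_inv_mul, le_div_iff₀ hw]
      have hcc : w * k ≤ (reachSet E {v}).card := hc
      simp only [hcc, true_and] at h3 ⊢
      linarith
    · exact le_add_of_nonneg_right (mul_nonneg (by positivity)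
          (Finset.sum_nonneg fun u _ => by positivity))
  have h3 := percExp_mono h.nonneg key
  rw [percExp_add, percExp_const_mul] at h3
  refine h3.trans ?_
  have h5 := mul_le_mul_of_nonneg_left h2 (by positivity : 0 ≤ 1 / w)
  have h6 : 1 / w * (k * (k * (9 * M / (w ^ 2 * k)))) = 9 * M / w ^ 3 * k := by
    field_simp
  rw [h6] at h5
  rw [add_mul, mul_comm T]
  exact add_le_add h1 h5

/-! ### Uniform coloring of the components -/

/-- The expectation of `f τ` when `τ` colors each component of `graphOf E` uniformly at random. -/
noncomputable def colorExp {n : ℕ} (q : ℕ) (E : Finset (Fin n × Fin n)) (f : Conf n q → ℝ) : ℝ :=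
  ∑ τ : Conf n q, (if ∀ u v : Fin n, (graphOf E).Reachable u v → τ u = τ v then
    ((q : ℝ))⁻¹ ^ numComps E else 0) * f τ

theorem sum_swStep_mul {n q : ℕ} (β : ℝ) (x : Conf n q) (f : Conf n q → ℝ) :
    ∑ τ, swStep n q β x τ * f τ
      = percExp (β / n) (monoPairs x) (fun E => colorExp q E f) := by
  simp only [swStep, percExp, colorExp, Finset.sum_mul, Finset.mul_sum]
  rw [Finset.sum_comm]
  exact Finset.sum_congr rfl fun E _ => Finset.sum_congr rfl fun τ _ => by ring

section colorExp

variable {n q : ℕ} {E : Finset (Fin n × Fin n)}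

theorem colorExp_mono {f g : Conf n q → ℝ}
    (h : ∀ τ, (∀ u v : Fin n, (graphOf E).Reachable u v → τ u = τ v) → f τ ≤ g τ) :
    colorExp q E f ≤ colorExp q E g := by
  unfold colorExp
  refine Finset.sum_le_sum fun τ _ => ?_
  split_ifs with hτ
  · exact mul_le_mul_of_nonneg_left (h τ hτ) (by positivity)
  · simp

theorem colorExp_add (f g : Conf n q → ℝ) :
    colorExp q E (fun τ => f τ + g τ) = colorExp q E f + colorExp q E g := by
  simp only [colorExp, mul_add, Finset.sum_add_distrib]

theorem colorExp_const_mul (c : ℝ) (f : Conf n q → ℝ) :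
    colorExp q E (fun τ => c * f τ) = c * colorExp q E f := by
  simp only [colorExp, Finset.mul_sum]
  exact Finset.sum_congr rfl fun τ _ => by ring

theorem colorExp_sum {ι : Type*} (s : Finset ι) (f : ι → Conf n q → ℝ) :
    colorExp q E (fun τ => ∑ i ∈ s, f i τ) = ∑ i ∈ s, colorExp q E (f i) := by
  simp only [colorExp, Finset.mul_sum]
  exact Finset.sum_comm

/-- The coloring expectation as an average over colorings of the set of components. -/
theorem colorExp_eq_sum [Fintype (graphOf E).ConnectedComponent] (f : Conf n q → ℝ) :
    colorExp q E f = ((q : ℝ))⁻¹ ^ Fintype.card (graphOf E).ConnectedComponent *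
      ∑ c : (graphOf E).ConnectedComponent → Fin q,
        f (fun v => c ((graphOf E).connectedComponentMk v)) := by
  unfold colorExp
  simp only [ite_mul, zero_mul]
  rw [← Finset.sum_filter, Finset.mul_sum, numComps, Nat.card_eq_fintype_card]
  symm
  refine Finset.sum_bij (fun c _ v => c ((graphOf E).connectedComponentMk v)) ?_ ?_ ?_ ?_
  · intro c _
    simp only [Finset.mem_filter, Finset.mem_univ, true_and]
    intro u v huv
    rw [SimpleGraph.ConnectedComponent.eq.2 huv]
  · intro c _ c' _ h
    funext k
    induction k using SimpleGraph.ConnectedComponent.ind with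
    | _ v => exact congrFun h v
  · intro τ hτ
    simp only [Finset.mem_filter, Finset.mem_univ, true_and] at hτ
    refine ⟨fun k => k.lift τ fun v w p _ => hτ v w p.reachable, Finset.mem_univ _, ?_⟩
    funext v
    rfl
  · intro c _
    rfl

theorem colorExp_const (hq : q ≠ 0) (c : ℝ) : colorExp q E (fun _ => c) = c := by
  have : Fintype (graphOf E).ConnectedComponent := Fintype.ofFinite _
  rw [colorExp_eq_sum]
  simp only [Finset.sum_const, Finset.card_univ, Fintype.card_fun, Fintype.card_fin,
    nsmul_eq_mul, Nat.cast_pow]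
  have : (q : ℝ) ≠ 0 := by exact_mod_cast hq
  rw [← mul_assoc, ← mul_pow, inv_mul_cancel₀ this, one_pow, one_mul]

/-- Vertices in different components have uncorrelated colors. -/
theorem colorExp_mul_eq_zero {u v : Fin n} (h : ¬ (graphOf E).Reachable u v)
    {φ ψ : Fin q → ℝ} (hφ : ∑ i, φ i = 0) :
    colorExp q E (fun τ => φ (τ u) * ψ (τ v)) = 0 := by
  have : Fintype (graphOf E).ConnectedComponent := Fintype.ofFinite _
  rw [colorExp_eq_sum]
  refine mul_eq_zero_of_right _ ?_
  set a := (graphOf E).connectedComponentMk u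
  set b := (graphOf E).connectedComponentMk v
  have hab : a ≠ b := fun hh => h (SimpleGraph.ConnectedComponent.eq.1 hh)
  have h1 := Finset.prod_univ_sum
    (fun _ : (graphOf E).ConnectedComponent => (univ : Finset (Fin q)))
    (fun k i => (if k = a then φ i else 1) * (if k = b then ψ i else 1))
  rw [Fintype.piFinset_univ] at h1
  simp only [Finset.prod_mul_distrib, Finset.prod_ite_eq', Finset.mem_univ, if_true] at h1
  rw [← h1]
  refine Finset.prod_eq_zero (Finset.mem_univ a) ?_
  simp [hab, hφ]

/-- The number of vertices of `U` receiving a given color has variance at most the sum of the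
component sizes over `U`. -/
theorem colorExp_sq_le (hq : q ≠ 0) (U : Finset (Fin n)) (j : Fin q) :
    colorExp q E (fun τ => (((U.filter (fun v => τ v = j)).card : ℝ) - U.card / q) ^ 2)
      ≤ ∑ v ∈ U, ((reachSet E {v}).card : ℝ) := by
  have hq0 : (0 : ℝ) < q := by exact_mod_cast Nat.pos_of_ne_zero hq
  have hq1 : (1 : ℝ) ≤ q := by exact_mod_cast Nat.one_le_iff_ne_zero.2 hq
  set φ : Fin q → ℝ := fun i => (if i = j then 1 else 0) - 1 / q with hφ
  have hφ0 : ∑ i, φ i = 0 := by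
    simp [hφ, Finset.sum_sub_distrib, hq0.ne']
  have hφ1 : ∀ i, |φ i| ≤ 1 := by
    intro i
    have h1 : 1 / (q : ℝ) ≤ 1 := by rw [div_le_one hq0]; exact hq1
    have h2 : 0 ≤ 1 / (q : ℝ) := by positivity
    simp only [hφ]
    rw [abs_le]
    split_ifs <;> constructor <;> linarith
  have h1 : ∀ τ : Conf n q, (((U.filter (fun v => τ v = j)).card : ℝ) - U.card / q) ^ 2
      = ∑ u ∈ U, ∑ v ∈ U, φ (τ u) * φ (τ v) := by
    intro τ
    rw [← Finset.sum_mul_sum, ← sq]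
    congr 1
    simp [hφ, Finset.sum_sub_distrib, div_eq_mul_inv]
  simp only [h1]
  rw [colorExp_sum]
  refine Finset.sum_le_sum fun u _ => ?_
  rw [colorExp_sum]
  calc ∑ v ∈ U, colorExp q E (fun τ => φ (τ u) * φ (τ v))
      ≤ ∑ v ∈ U, (if (graphOf E).Reachable u v then 1 else 0) := by
        refine Finset.sum_le_sum fun v _ => ?_
        split_ifs with h
        · rw [← colorExp_const (E := E) hq 1]
          refine colorExp_mono fun τ _ => (le_abs_self _).trans ?_
          rw [abs_mul]
          exact mul_le_one₀ (hφ1 _) (abs_nonneg _) (hφ1 _)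
        · exact (colorExp_mul_eq_zero h hφ0).le
    _ ≤ ((reachSet E {u}).card : ℝ) := by
        rw [Finset.sum_boole]
        refine Nat.cast_le.2 (Finset.card_le_card fun v hv => ?_)
        exact mem_reachSet_singleton.2 (Finset.mem_filter.1 hv).2

end colorExp

/-! ### Sorted proportions -/

section Sorted

variable {n q : ℕ}

theorem alphaVec_antitone (X : Conf n q) : Antitone (alphaVec X) := by
  intro i i' h
  exact Tuple.monotone_sort (cntFrac X) (Fin.rev_le_rev.2 h)

theorem alphaVec_rev_sort_symm (X : Conf n q) (j : Fin q) :
    alphaVec X ((Tuple.sort (cntFrac X)).symm j).rev = cntFrac X j := by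
  simp [alphaVec]

theorem abs_sub_le_linf (f g : Fin q → ℝ) (i : Fin q) : |f i - g i| ≤ linf f g :=
  le_ciSup (f := fun i => |f i - g i|) (Set.finite_range _).bddAbove i

/-- Closeness of the unsorted proportions to a vector with one large entry transfers to the
sorted proportions. -/
theorem linf_alphaVec_le (hq : q ≠ 0) (X : Conf n q) (s : Fin q) {b δ : ℝ}
    (hb : (1 - b) / ((q : ℝ) - 1) ≤ b) (hs : |cntFrac X s - b| ≤ δ)
    (ho : ∀ j, j ≠ s → |cntFrac X j - (1 - b) / ((q : ℝ) - 1)| ≤ δ) :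
    linf (alphaVec X) (kappaVec q b) ≤ δ := by
  have : NeZero q := ⟨hq⟩
  set o := (1 - b) / ((q : ℝ) - 1) with hodef
  refine ciSup_le fun i => ?_
  have hval : ∀ i, alphaVec X i = cntFrac X (Tuple.sort (cntFrac X) i.rev) := fun _ => rfl
  set j := Tuple.sort (cntFrac X) i.rev with hj
  have hs' := abs_le.1 hs
  by_cases hi : (i : ℕ) = 0
  · rw [kappaVec, if_pos hi]
    have h1 : alphaVec X ((Tuple.sort (cntFrac X)).symm s).rev ≤ alphaVec X i :=
      alphaVec_antitone X (by
        rw [Fin.le_def]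
        omega)
    rw [alphaVec_rev_sort_symm] at h1
    have h2 : alphaVec X i ≤ b + δ := by
      rw [hval, ← hj]
      by_cases hjs : j = s
      · rw [hjs]
        linarith
      · have := abs_le.1 (ho j hjs)
        linarith
    rw [abs_le]
    constructor <;> linarith
  · rw [kappaVec, if_neg hi, ← hodef]
    by_cases hjs : j = s
    · have h1 : alphaVec X i ≤ alphaVec X 0 := alphaVec_antitone X (Fin.zero_le i)
      have h2 : Tuple.sort (cntFrac X) (Fin.rev 0) ≠ s := by
        rw [← hjs, hj]
        intro h
        have h3 := Fin.rev_injective ((Tuple.sort (cntFrac X)).injective h)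
        exact hi (by rw [← h3]; rfl)
      have h4 := abs_le.1 (ho _ h2)
      rw [hval 0] at h1
      rw [hval, ← hj, hjs] at h1 ⊢
      rw [abs_le]
      constructor <;> linarith
    · rw [hval]
      exact ho j hjs

theorem card_spinClass (X : Conf n q) (j : Fin q) : (spinClass X j).card = cntN X j := rfl

theorem exists_dominant (hq : q ≠ 0) (X : Conf n q) :
    ∃ s, alpha1 X = cntFrac X s ∧ ∀ j, cntN X j ≤ cntN X s := by
  have : Nonempty (Fin q) := ⟨⟨0, Nat.pos_of_ne_zero hq⟩⟩
  obtain ⟨s, hs⟩ := Finite.exists_max (cntN X)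
  obtain ⟨hj, hmax⟩ := Nat.sInf_mem
    (s := {j : ℕ | ∃ hj : j < q, ∀ j' : Fin q, cntN X j' ≤ cntN X ⟨j, hj⟩}) ⟨s, s.2, hs⟩
  refine ⟨⟨domIdx X, hj⟩, ?_, hmax⟩
  simp [alpha1, cntFrac, cntN, Fin.ext_iff]

/-- The proportions of a configuration whose sorted proportions are close to `mVec`. -/
theorem cntFrac_of_linf_le (hq : q ≠ 0) {β ε : ℝ} {X : Conf n q}
    (h : linf (alphaVec X) (mVec q β) ≤ ε) {s : Fin q} (hs : ∀ j, cntN X j ≤ cntN X s) :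
    |cntFrac X s - aFix q β| ≤ ε ∧
      ∀ j, j ≠ s → cntFrac X j ≤ (1 - aFix q β) / ((q : ℝ) - 1) + ε := by
  have : NeZero q := ⟨hq⟩
  have hs' : ∀ j, cntFrac X j ≤ cntFrac X s := fun j =>
    div_le_div_of_nonneg_right (Nat.cast_le.2 (hs j)) (Nat.cast_nonneg n)
  have hi : ∀ i : Fin q, i ≠ 0 → alphaVec X i ≤ (1 - aFix q β) / ((q : ℝ) - 1) + ε := by
    intro i hi
    have h1 := (abs_sub_le_linf (alphaVec X) (mVec q β) i).trans h
    rw [mVec, kappaVec, if_neg (fun h0 => hi (Fin.val_eq_zero_iff.1 h0))] at h1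
    linarith [(abs_le.1 h1).2]
  have h0 : alphaVec X 0 = cntFrac X s := by
    refine le_antisymm (hs' _) ?_
    rw [← alphaVec_rev_sort_symm X s]
    exact alphaVec_antitone X (Fin.zero_le _)
  constructor
  · have h1 := (abs_sub_le_linf (alphaVec X) (mVec q β) 0).trans h
    rwa [h0, mVec, kappaVec, if_pos (Fin.val_eq_zero_iff.2 rfl)] at h1
  · intro j hj
    by_cases h1 : ((Tuple.sort (cntFrac X)).symm j).rev = 0
    · refine (hs' j).trans ?_
      rw [← alphaVec_rev_sort_symm X s]
      refine hi _ fun h2 => hj ?_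
      exact (Tuple.sort (cntFrac X)).symm.injective (Fin.rev_injective (h1.trans h2.symm))
    · rw [← alphaVec_rev_sort_symm X j]
      exact hi _ h1

end Sorted

/-! ### Deviation of the new proportions -/

theorem sq_le_of_abs_le_one {c X Y D : ℝ} (hc : |c| ≤ 1) (h : X ^ 2 + Y ^ 2 ≤ D) :
    (c * X + Y) ^ 2 ≤ 2 * D := by
  have h1 : c ^ 2 ≤ 1 := by
    rw [← sq_abs]
    exact pow_le_one₀ (abs_nonneg c) hc
  have h3 := mul_le_mul_of_nonneg_right h1 (sq_nonneg X)
  nlinarith [sq_nonneg (c * X - Y)]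

theorem one_sub_F_div {q : ℕ} (hq : 2 ≤ q) (β a : ℝ) :
    (1 - F q β a) / ((q : ℝ) - 1) = (1 - theta (β * a) * a) / q := by
  have hq2 : (2 : ℝ) ≤ q := by exact_mod_cast hq
  have hq1 : (q : ℝ) - 1 ≠ 0 := by linarith
  have hq0 : (q : ℝ) ≠ 0 := by linarith
  rw [F]
  field_simp
  ring

theorem one_sub_F_div_le {q : ℕ} (hq : 2 ≤ q) (β : ℝ) {a : ℝ} (ha : 0 ≤ a) :
    (1 - F q β a) / ((q : ℝ) - 1) ≤ F q β a := by
  have hq2 : (2 : ℝ) ≤ q := by exact_mod_cast hq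
  have h1 : 0 ≤ theta (β * a) * a := mul_nonneg (theta_nonneg_le_one _).1 ha
  rw [one_sub_F_div hq, F, show (1 - theta (β * a) * a) / (q : ℝ)
    = 1 / q - 1 / q * (theta (β * a) * a) by ring, mul_assoc]
  linarith [show (1 - 1 / (q : ℝ)) * (theta (β * a) * a)
    = theta (β * a) * a - 1 / q * (theta (β * a) * a) by ring]

theorem linf_sq_le {n q : ℕ} (hq : 2 ≤ q) (hn : n ≠ 0) (β a : ℝ) (ha : 0 ≤ a)
    {E : Finset (Fin n × Fin n)} {τ : Conf n q} (v : Fin n)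
    (hτ : ∀ u v : Fin n, (graphOf E).Reachable u v → τ u = τ v) :
    linf (alphaVec τ) (kappaVec q (F q β a)) ^ 2 ≤
      2 / (n : ℝ) ^ 2 * ((((reachSet E {v}).card : ℝ) - theta (β * a) * (a * n)) ^ 2 +
        ∑ j : Fin q, ((((univ \ reachSet E {v}).filter (fun u => τ u = j)).card : ℝ)
          - ((univ \ reachSet E {v}).card : ℝ) / q) ^ 2) := by
  set B := reachSet E {v} with hB
  set U := univ \ B with hU
  set R : Fin q → ℝ := fun j => ((U.filter (fun u => τ u = j)).card : ℝ) with hR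
  set T := theta (β * a) with hT
  have hT0 : 0 ≤ T := (theta_nonneg_le_one _).1
  have hn0 : (0 : ℝ) < n := by exact_mod_cast Nat.pos_of_ne_zero hn
  have hq2 : (2 : ℝ) ≤ q := by exact_mod_cast hq
  have hUc : (U.card : ℝ) = n - B.card := by
    rw [hU, Finset.card_univ_sdiff, Nat.cast_sub (Finset.card_le_univ B), Fintype.card_fin]
  have hcnt : ∀ j, (cntN τ j : ℝ) = (B.filter (fun u => τ u = j)).card + R j := by
    intro j
    have h1 : (univ : Finset (Fin n)) = B ∪ U := by
      rw [hU, Finset.union_sdiff_of_subset (Finset.subset_univ B)]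
    unfold cntN
    rw [h1, Finset.filter_union, Finset.card_union_of_disjoint, Nat.cast_add]
    exact Finset.disjoint_filter_filter (hU ▸ Finset.disjoint_sdiff)
  have hBmono : ∀ u ∈ B, τ u = τ v := fun u hu => (hτ _ _ (mem_reachSet_singleton.1 hu)).symm
  have hs : (cntN τ (τ v) : ℝ) = B.card + R (τ v) := by
    rw [hcnt, Finset.filter_true_of_mem hBmono]
  have ho : ∀ j, j ≠ τ v → (cntN τ j : ℝ) = R j := by
    intro j hj
    rw [hcnt, Finset.filter_false_of_mem fun u hu h => hj (h.symm.trans (hBmono u hu))]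
    simp
  set D := ((B.card : ℝ) - T * (a * n)) ^ 2 + ∑ j, (R j - (U.card : ℝ) / q) ^ 2 with hD
  have hDj : ∀ j, ((B.card : ℝ) - T * (a * n)) ^ 2 + (R j - (U.card : ℝ) / q) ^ 2 ≤ D := by
    intro j
    have := Finset.single_le_sum (f := fun j => (R j - (U.card : ℝ) / q) ^ 2)
      (fun j _ => sq_nonneg _) (Finset.mem_univ j)
    linarith
  have hdev : ∀ c : ℝ, |c| ≤ 1 → ∀ j,
      |(c * ((B.card : ℝ) - T * (a * n)) + (R j - (U.card : ℝ) / q)) / n|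
        ≤ √(2 / (n : ℝ) ^ 2 * D) := by
    intro c hc j
    apply Real.abs_le_sqrt
    rw [div_pow, div_mul_eq_mul_div]
    exact div_le_div_of_nonneg_right (sq_le_of_abs_le_one hc (hDj j)) (by positivity)
  have hq0 : (q : ℝ) ≠ 0 := by linarith
  have hinv : 1 / (q : ℝ) ≤ 1 := by
    rw [div_le_one (by linarith)]
    linarith
  have hinv0 : 0 ≤ 1 / (q : ℝ) := by positivity
  have hlin : linf (alphaVec τ) (kappaVec q (F q β a)) ≤ √(2 / (n : ℝ) ^ 2 * D) := by
    apply linf_alphaVec_le (by omega) τ (τ v) (one_sub_F_div_le hq β ha)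
    · have h1 : cntFrac τ (τ v) - F q β a
          = ((1 - 1 / (q : ℝ)) * ((B.card : ℝ) - T * (a * n))
            + (R (τ v) - (U.card : ℝ) / q)) / n := by
        rw [cntFrac, hs, hUc, F, ← hT]
        clear_value T R B
        field_simp
        ring
      rw [h1]
      exact hdev _ (by rw [abs_le]; constructor <;> linarith) _
    · intro j hj
      have h1 : cntFrac τ j - (1 - F q β a) / ((q : ℝ) - 1)
          = ((-(1 / (q : ℝ))) * ((B.card : ℝ) - T * (a * n)) + (R j - (U.card : ℝ) / q)) / n := by
        rw [one_sub_F_div hq, cntFrac, ho j hj, hUc, ← hT]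
        generalize R j = y
        clear_value T B
        field_simp
        ring
      rw [h1]
      exact hdev _ (by rw [abs_le]; constructor <;> linarith) _
  have h0 : 0 ≤ linf (alphaVec τ) (kappaVec q (F q β a)) := Real.iSup_nonneg fun i => abs_nonneg _
  calc linf (alphaVec τ) (kappaVec q (F q β a)) ^ 2
      ≤ √(2 / (n : ℝ) ^ 2 * D) ^ 2 := pow_le_pow_left₀ h0 hlin 2
    _ = 2 / (n : ℝ) ^ 2 * D := Real.sq_sqrt (mul_nonneg (by positivity)
        (add_nonneg (sq_nonneg _) (Finset.sum_nonneg fun j _ => sq_nonneg _)))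

/-! ### Configurations near the majority vector -/

theorem sum_cntN {n q : ℕ} (X : Conf n q) : ∑ j, cntN X j = n := by
  have h := Finset.card_eq_sum_card_fiberwise (f := X) (s := univ) (t := univ)
    (fun v _ => Finset.mem_coe.2 (Finset.mem_univ _))
  rw [Finset.card_univ, Fintype.card_fin] at h
  exact h.symm

theorem one_div_le_cntFrac {n q : ℕ} (hn : n ≠ 0) (hq : q ≠ 0) {X : Conf n q} {s : Fin q}
    (hs : ∀ j, cntN X j ≤ cntN X s) : 1 / (q : ℝ) ≤ cntFrac X s := by
  have h1 : n ≤ q * cntN X s := by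
    calc n = ∑ j, cntN X j := (sum_cntN X).symm
      _ ≤ ∑ _j : Fin q, cntN X s := Finset.sum_le_sum fun j _ => hs j
      _ = q * cntN X s := by simp
  have hn0 : (0 : ℝ) < n := by exact_mod_cast Nat.pos_of_ne_zero hn
  have hq0 : (0 : ℝ) < q := by exact_mod_cast Nat.pos_of_ne_zero hq
  have h2 : (n : ℝ) ≤ q * cntN X s := by exact_mod_cast h1
  rw [cntFrac, div_le_div_iff₀ hq0 hn0]
  linarith

/-- Near the majority vector the dominant class is uniformly supercritical and every other class
is uniformly subcritical. -/
theorem exists_uniform_criticality {q : ℕ} (hq : 2 ≤ q) {β : ℝ} (hβ : (q : ℝ) < β) :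
    ∃ ε L w g d δ : ℝ, 0 < ε ∧ 0 < δ ∧
      ∃ N : ℕ, N ≠ 0 ∧ ∀ n : ℕ, N ≤ n → ∀ x : Conf n q,
        linf (alphaVec x) (mVec q β) ≤ ε → ∃ s, alpha1 x = cntFrac x s ∧
          IsSupercritical (β / n) x s L w g d ∧
            ∀ j, j ≠ s → δ ≤ 1 - β / n * (spinClass x j).card := by
  have hq2 : (2 : ℝ) ≤ q := by exact_mod_cast hq
  have hβ0 : 0 < β := by linarith
  rcases aFix_spec hq hβ with ha | ⟨ha, hO⟩
  · refine ⟨1 / (2 * q), 1, 1, 1, 1, 1, by positivity, one_pos, 1, one_ne_zero, fun n hn x hx => ?_⟩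
    exfalso
    obtain ⟨s, -, hs⟩ := exists_dominant (by omega) x
    have h1 := (cntFrac_of_linf_le (by omega) hx hs).1
    have h2 := one_div_le_cntFrac (by omega) (by omega) hs
    rw [ha, sub_zero] at h1
    have h3 := (le_abs_self _).trans h1
    have h4 : 1 / (2 * (q : ℝ)) = 1 / q / 2 := by ring
    have h5 : 0 < 1 / (q : ℝ) := by positivity
    linarith
  set a := aFix q β with hadef
  set o := (1 - a) / ((q : ℝ) - 1) with hodef
  set lam := (β * a + 1) / 2 with hlam
  have hlam1 : 1 < lam := by linarith
  set z := (lam - 1) / (2 * lam) with hz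
  have hlz : lam * z = (lam - 1) / 2 := by
    rw [hz]
    field_simp
  have hz0 : 0 < z := div_pos (by linarith) (by linarith)
  have hz1 : z ≤ 1 := by
    rw [hz, div_le_one (by linarith)]
    linarith
  obtain ⟨g, hg0, hg1, hg⟩ := exists_exp_gap hz0
    (exp_neg_mul_lt (by linarith) hz0 (by linarith : lam * z < lam - 1))
  have hd : Real.exp (-lam * (z / 2)) < 1 - z / 2 :=
    exp_neg_mul_lt (by linarith) (by linarith) (by linarith)
  set ε := min ((β * a - 1) / (2 * β)) ((1 - β * o) / (2 * β)) with hε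
  have hε0 : 0 < ε := lt_min (div_pos (by linarith) (by linarith))
    (div_pos (by linarith) (by linarith))
  have hε1 : β * ε ≤ (β * a - 1) / 2 := by
    have h1 : ε ≤ (β * a - 1) / (2 * β) := min_le_left _ _
    rw [le_div_iff₀ (by positivity)] at h1
    linarith
  have hε2 : β * ε ≤ (1 - β * o) / 2 := by
    have h1 : ε ≤ (1 - β * o) / (2 * β) := min_le_right _ _
    rw [le_div_iff₀ (by positivity)] at h1
    linarith
  refine ⟨ε, β, z / 2, g, 1 - z / 2 - Real.exp (-lam * (z / 2)), (1 - β * o) / 2, hε0,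
    by linarith, ⌈β / g⌉₊ + 1, by omega, fun n hn x hx => ?_⟩
  obtain ⟨s, hs1, hs⟩ := exists_dominant (by omega) x
  obtain ⟨h1, h2⟩ := cntFrac_of_linf_le (by omega) hx hs
  have hn0 : (0 : ℝ) < n := by exact_mod_cast (by omega : 0 < n)
  have hbk : ∀ j, β / n * (spinClass x j).card = β * cntFrac x j := by
    intro j
    rw [card_spinClass, cntFrac]
    ring
  have hlow : lam ≤ β * cntFrac x s := by
    have h3 : a - ε ≤ cntFrac x s := by linarith [(abs_le.1 h1).1]
    have h4 := mul_le_mul_of_nonneg_left h3 hβ0.le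
    rw [mul_sub] at h4
    linarith
  have hle1 : cntFrac x s ≤ 1 := by
    rw [cntFrac, div_le_one hn0]
    have : cntN x s ≤ n := by
      rw [← card_spinClass]
      exact (Finset.card_le_univ _).trans_eq (Fintype.card_fin n)
    exact_mod_cast this
  have hsize : (n : ℝ) ≤ β * (spinClass x s).card := by
    have h3 : 1 ≤ β / n * (spinClass x s).card := by
      rw [hbk]
      linarith
    rw [div_mul_eq_mul_div, le_div_iff₀ hn0] at h3
    linarith
  refine ⟨s, hs1, ⟨by positivity, by rw [hbk]; linarith, ?_, hsize, by linarith, by linarith,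
    hg0, hg1, ?_, by linarith, ?_, ?_⟩, ?_⟩
  · rw [hbk]
    nlinarith
  · have h3 : β / g ≤ n := by
      refine (Nat.le_ceil _).trans (Nat.cast_le.2 (by omega))
    rw [div_le_iff₀ hg0] at h3
    have h4 := mul_le_mul_of_nonneg_left hsize hg0.le
    have h5 : β * 1 ≤ β * (g * (spinClass x s).card) := by linarith
    exact le_of_mul_le_mul_left h5 hβ0
  · rw [hbk]
    have h3 : Real.exp (-(β * cntFrac x s) * (z / 2)) ≤ Real.exp (-lam * (z / 2)) :=
      Real.exp_le_exp.2 (mul_le_mul_of_nonneg_right (by linarith) (by linarith))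
    linarith
  · intro m hm
    have hk : (0 : ℝ) < (spinClass x s).card := by
      by_contra! h0
      nlinarith
    apply hg
    · rw [hbk]
      exact hlow
    · positivity
    · rw [div_le_iff₀ hk]
      linarith
  · intro j hj
    rw [hbk]
    have h3 := mul_le_mul_of_nonneg_left (h2 j hj) hβ0.le
    rw [mul_add] at h3
    linarith

/-! ### The mean square deviation after one step -/

theorem swStep_nonneg {n q : ℕ} {β : ℝ} (hβ : 0 ≤ β) (x τ : Conf n q) :
    0 ≤ swStep n q β x τ := by
  have h1 : 0 ≤ 1 - Real.exp (-(β / n)) := by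
    have : Real.exp (-(β / n)) ≤ 1 := Real.exp_le_one_iff.2 (by
      have : 0 ≤ β / n := by positivity
      linarith)
    linarith
  refine Finset.sum_nonneg fun E _ => mul_nonneg (by positivity) ?_
  split_ifs <;> positivity

theorem sum_swStep_linf_sq_le {n q : ℕ} (hq : 2 ≤ q) (hn : n ≠ 0) {β : ℝ} {x : Conf n q}
    {s : Fin q} {L w g d δ : ℝ} (hs : alpha1 x = cntFrac x s)
    (h : IsSupercritical (β / n) x s L w g d) (hδ : 0 < δ)
    (hsub : ∀ j, j ≠ s → δ ≤ 1 - β / n * (spinClass x j).card) :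
    ∑ τ, swStep n q β x τ * linf (alphaVec τ) (kappaVec q (F q β (alpha1 x))) ^ 2
      ≤ 2 * (((4 + Real.exp (2 * L)) / d ^ 2 / w + 12 * (L + 1) / (g ^ 2 / 2 * w) ^ 3)
        + q * (((∑' m : ℕ, (m : ℝ) * Real.exp (-(g ^ 2 / 2 * m)))
          + 9 * ((4 + Real.exp (2 * L)) / d ^ 2) / w ^ 3) + 2 / δ)) / n := by
  set A₁ := (4 + Real.exp (2 * L)) / d ^ 2 / w + 12 * (L + 1) / (g ^ 2 / 2 * w) ^ 3 with hA₁
  set A₂ := (∑' m : ℕ, (m : ℝ) * Real.exp (-(g ^ 2 / 2 * m)))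
    + 9 * ((4 + Real.exp (2 * L)) / d ^ 2) / w ^ 3 with hA₂
  have hn0 : (0 : ℝ) < n := by exact_mod_cast Nat.pos_of_ne_zero hn
  set S := spinClass x s with hS
  have hk := h.card_pos
  have hw := h.w_pos
  have hg := h.g_pos
  have hd := h.d_pos
  have hL : 0 < L := by linarith [h.one_lt, h.le_bound]
  have hA₁0 : 0 ≤ A₁ := by positivity
  have hA₂0 : 0 ≤ A₂ := add_nonneg (tsum_nonneg fun m => by positivity) (by positivity)
  have hkn : (S.card : ℝ) ≤ n := by
    exact_mod_cast (Finset.card_le_univ S).trans_eq (Fintype.card_fin n)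
  have hSne : S.Nonempty := Finset.card_pos.1 (by exact_mod_cast hk)
  choose r hr hmax using fun E : Finset (Fin n × Fin n) =>
    Finset.exists_max_image S (fun v => (reachSet E {v}).card) hSne
  have hα : alpha1 x * n = S.card := by
    rw [hs, cntFrac, div_mul_cancel₀ _ hn0.ne']
    rfl
  have hα0 : 0 ≤ alpha1 x := by
    rw [hs]
    exact div_nonneg (Nat.cast_nonneg _) hn0.le
  have hθ : β * alpha1 x = β / n * S.card := by
    rw [← hα]
    field_simp
  rw [sum_swStep_mul]
  set P := monoPairs x
  have hstep : ∀ E ⊆ P,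
      colorExp q E (fun τ => linf (alphaVec τ) (kappaVec q (F q β (alpha1 x))) ^ 2)
        ≤ 2 / (n : ℝ) ^ 2 *
          ((((reachSet E {r E}).card : ℝ) - theta (β / n * S.card) * S.card) ^ 2 +
            q * ((∑ v ∈ S \ reachSet E {r E}, ((reachSet E {v}).card : ℝ))
              + ∑ v ∈ univ \ S, ((reachSet E {v}).card : ℝ))) := by
    intro E hE
    have hBS : reachSet E {r E} ⊆ S :=
      reachSet_subset_spinClass hE (Finset.singleton_subset_iff.2 (hr E))
    have hU : univ \ reachSet E {r E} = (S \ reachSet E {r E}) ∪ (univ \ S) := by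
      rw [Finset.union_comm, Finset.sdiff_union_sdiff_cancel (Finset.subset_univ _) hBS]
    refine (colorExp_mono fun τ hτ => linf_sq_le hq hn β _ hα0 (r E) hτ).trans ?_
    rw [colorExp_const_mul, colorExp_add, colorExp_const (by omega), colorExp_sum, hθ, hα]
    refine mul_le_mul_of_nonneg_left (add_le_add le_rfl ?_) (by positivity)
    refine (Finset.sum_le_sum fun j _ => colorExp_sq_le (by omega) _ j).trans ?_
    rw [Finset.sum_const, Finset.card_univ, Fintype.card_fin, nsmul_eq_mul, hU,
      Finset.sum_union]
    exact Finset.disjoint_of_subset_left Finset.sdiff_subset Finset.disjoint_sdiff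
  refine (percExp_mono h.nonneg hstep).trans ?_
  rw [percExp_const_mul, percExp_add, percExp_const_mul, percExp_add]
  have h1 := h.largest_dev_le hr hmax
  have h2 := h.rest_le hmax hr
  have h3 : percExp (β / n) P (fun E => ∑ v ∈ univ \ S, ((reachSet E {v}).card : ℝ))
      ≤ n * (2 / δ) := by
    rw [percExp_sum]
    calc ∑ v ∈ univ \ S, percExp (β / n) P (fun E => ((reachSet E {v}).card : ℝ))
        ≤ ∑ v ∈ univ \ S, 2 / δ := by
          refine Finset.sum_le_sum fun v hv => ?_
          have hne : x v ≠ s := fun h0 =>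
            (Finset.mem_sdiff.1 hv).2 (mem_spinClass.2 h0)
          have h4 := hsub _ hne
          refine (percExp_subcritical (β / n) h.nonneg x (x v) (mem_spinClass.2 rfl)
            (by linarith)).trans ?_
          exact div_le_div_of_nonneg_left (by norm_num) hδ h4
      _ ≤ n * (2 / δ) := by
          rw [Finset.sum_const, nsmul_eq_mul]
          refine mul_le_mul_of_nonneg_right ?_ (by positivity)
          exact_mod_cast (Finset.card_le_univ (univ \ S)).trans_eq (Fintype.card_fin n)
  rw [← hA₁] at h1
  rw [← hA₂] at h2
  have h4 := mul_le_mul_of_nonneg_left hkn hA₁0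
  have h5 := mul_le_mul_of_nonneg_left hkn hA₂0
  calc _ ≤ 2 / (n : ℝ) ^ 2 * (A₁ * n + q * (A₂ * n + n * (2 / δ))) := by
        refine mul_le_mul_of_nonneg_left (add_le_add (h1.trans h4) ?_) (by positivity)
        exact mul_le_mul_of_nonneg_left (add_le_add (h2.trans h5) h3) (Nat.cast_nonneg q)
    _ = _ := by
        clear_value A₁ A₂
        field_simp

/-- Markov's inequality for the squared deviation after one step. -/
theorem sum_swStep_tail_le {n q : ℕ} (hn : n ≠ 0) {β : ℝ} (hβ : 0 ≤ β) (x : Conf n q)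
    (f : Conf n q → ℝ) {r C : ℝ} (hr : 0 < r)
    (h : ∑ τ, swStep n q β x τ * f τ ^ 2 ≤ C / n) :
    ∑ τ, (if r / Real.sqrt n ≤ f τ then swStep n q β x τ else 0) ≤ C / r ^ 2 := by
  have hn0 : (0 : ℝ) < n := by exact_mod_cast Nat.pos_of_ne_zero hn
  calc ∑ τ, (if r / Real.sqrt n ≤ f τ then swStep n q β x τ else 0)
      ≤ ∑ τ, n / r ^ 2 * (swStep n q β x τ * f τ ^ 2) := by
        refine Finset.sum_le_sum fun τ _ => ?_
        have h0 := swStep_nonneg hβ x τ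
        split_ifs with hτ
        · have h1 : r ^ 2 / n ≤ f τ ^ 2 := by
            have := pow_le_pow_left₀ (by positivity) hτ 2
            rwa [div_pow, Real.sq_sqrt hn0.le] at this
          have h2 : 1 ≤ n / r ^ 2 * f τ ^ 2 := by
            rw [div_le_iff₀ hn0] at h1
            rw [div_mul_eq_mul_div, le_div_iff₀ (by positivity)]
            linarith
          nlinarith
        · positivity
    _ ≤ n / r ^ 2 * (C / n) := by
        rw [← Finset.mul_sum]
        exact mul_le_mul_of_nonneg_left h (by positivity)
    _ = C / r ^ 2 := by field_simp

/-- Lemma 4.4: one-step concentration of the proportions vector: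
from a configuration near `m`, after one SW step the proportions vector is within
`r/√n` of `κ(F(α₁(x)))` except with probability `e^{-c₁ r} + C₁ r⁻²`. -/
theorem sw_step_concentration (q : ℕ) (hq : 2 ≤ q) (β : ℝ) (hβ : (q : ℝ) < β) :
    ∃ ε₀ γ₀ c₁ C₁ : ℝ, 0 < ε₀ ∧ 0 < γ₀ ∧ 0 < c₁ ∧ 0 < C₁ ∧
      ∃ N : ℕ, ∀ n : ℕ, N ≤ n → ∀ x : Conf n q,
        linf (alphaVec x) (mVec q β) ≤ ε₀ → ∀ r : ℝ, γ₀ ≤ r →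
          (∑ τ : Conf n q,
            if r / Real.sqrt n ≤ linf (alphaVec τ) (kappaVec q (F q β (alpha1 x)))
              then swStep n q β x τ else 0)
            ≤ Real.exp (-c₁ * r) + C₁ / r ^ 2 := by
  have hβ0 : 0 < β := lt_trans (by positivity) hβ
  obtain ⟨ε, L, w, g, d, δ, hε, hδ, N, hN, h⟩ := exists_uniform_criticality hq hβ
  set C := 2 * (((4 + Real.exp (2 * L)) / d ^ 2 / w + 12 * (L + 1) / (g ^ 2 / 2 * w) ^ 3)
    + q * (((∑' m : ℕ, (m : ℝ) * Real.exp (-(g ^ 2 / 2 * m)))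
      + 9 * ((4 + Real.exp (2 * L)) / d ^ 2) / w ^ 3) + 2 / δ)) with hC
  refine ⟨ε, 1, 1, |C| + 1, hε, one_pos, one_pos, by positivity, N, fun n hn x hx r hr => ?_⟩
  obtain ⟨s, hs, hsup, hsub⟩ := h n hn x hx
  have hn0 : n ≠ 0 := by omega
  refine (sum_swStep_tail_le hn0 hβ0.le x _ (by linarith)
    (sum_swStep_linf_sq_le hq hn0 hs hsup hδ hsub)).trans ?_
  rw [← hC]
  have h1 : C / r ^ 2 ≤ (|C| + 1) / r ^ 2 :=
    div_le_div_of_nonneg_right (by linarith [le_abs_self C]) (by positivity)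
  linarith [Real.exp_pos (-1 * r)]
end
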